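/- arXiv:1206.3176 — 2 statements merged into one kernel-verified Lean document; each statement's English description precedes it below -/
import Mathlib

section
/- Let Ω ⊆ ℝ^{n+1} be a nonempty proper open convex cone and let F be a canonical potential of Ω. For x ∈ Ω write g = D²F(x), T = D³F(x), and define ‖T‖²_g = Σ T_{ijk} T_{abc} (g⁻¹)^{ia}(g⁻¹)^{jb}(g⁻¹)^{kc} (all indices summed from 1 to n+1), and define the scalar curvature of the Hessian metric by R(x) = (1/4)·( ‖T‖²_g − 4·⟨∇F(x), (D²F(x))⁻¹∇F(x)⟩ ). Then −n(n−1)/(n+1) ≤ R(x) ≤ 0 for every x ∈ Ω; equivalently, 4(3n+1)/(n+1) ≤ ‖D³F(x)‖²_g ≤ 4(n+1) for every x ∈ Ω. -/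
open scoped RealInnerProductSpace

noncomputable section

abbrev Euc (m : ℕ) : Type := EuclideanSpace ℝ (Fin m)

/-- The Hessian matrix of `F` at `x` in the standard coordinates. -/
def hessMatrix {m : ℕ} (F : Euc m → ℝ) (x : Euc m) : Matrix (Fin m) (Fin m) ℝ :=
  fun i j => iteratedFDeriv ℝ 2 F x ![EuclideanSpace.single i 1, EuclideanSpace.single j 1]

/-- A nonempty proper open convex cone in `ℝ^m`. -/
def IsOpenProperConvexCone {m : ℕ} (Ω : Set (Euc m)) : Prop :=
  Ω.Nonempty ∧ IsOpen Ω ∧ Convex ℝ Ω ∧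
    (∀ x ∈ Ω, ∀ t : ℝ, Real.exp t • x ∈ Ω) ∧
    ¬ ∃ p v : Euc m, v ≠ 0 ∧ ∀ t : ℝ, p + t • v ∈ closure Ω

/-- `F` tends to `+∞` along every sequence in `Ω` converging to a boundary point of `Ω`. -/
def BlowsUpOnBoundary {m : ℕ} (Ω : Set (Euc m)) (F : Euc m → ℝ) : Prop :=
  ∀ z ∈ frontier Ω, ∀ x : ℕ → Euc m, (∀ k, x k ∈ Ω) →
    Filter.Tendsto x Filter.atTop (nhds z) →
    Filter.Tendsto (fun k => F (x k)) Filter.atTop Filter.atTop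

/-- The canonical potential of a proper open convex cone `Ω ⊆ ℝ^{n+1}`. -/
def IsCanonicalPotential (n : ℕ) (Ω : Set (Euc (n+1))) (F : Euc (n+1) → ℝ) : Prop :=
  ContDiffOn ℝ (⊤ : ℕ∞) F Ω ∧
  (∀ x ∈ Ω, (hessMatrix F x).PosDef) ∧
  (∀ x ∈ Ω, (hessMatrix F x).det = Real.exp (2 * F x)) ∧
  (∀ x ∈ Ω, ∀ t : ℝ, F (Real.exp t • x) = F x - (n + 1) * t) ∧
  BlowsUpOnBoundary Ω F

/-- The open dual cone of `Ω`. -/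
def openDualCone {m : ℕ} (Ω : Set (Euc m)) : Set (Euc m) :=
  {y | ∀ x ∈ closure Ω, x ≠ 0 → 0 < ⟪x, y⟫}

set_option linter.unusedSectionVars false
set_option linter.unusedSimpArgs false

section SmoothRing
open TopologicalSpace ContDiff
variable {E : Type*} [NormedAddCommGroup E] [NormedSpace ℝ E]

/-- Extension by zero of a function on an open set. -/
def extz (Ω : Opens E) (f : Ω → ℝ) : E → ℝ :=
  open Classical in fun x => if h : x ∈ Ω then f ⟨x, h⟩ else 0

lemma extz_apply {Ω : Opens E} (f : Ω → ℝ) (x : Ω) : extz Ω f x = f x := by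
  simp [extz]

lemma extz_of_mem {Ω : Opens E} (f : Ω → ℝ) {x : E} (h : x ∈ Ω) : extz Ω f x = f ⟨x, h⟩ := by
  simp [extz, h]

lemma extz_restrict {Ω : Opens E} (g : E → ℝ) : Set.EqOn (extz Ω (fun x => g x)) g Ω := by
  intro x hx
  exact extz_of_mem _ hx

/-- The algebra of smooth real functions on an open set. -/
def SFalg (Ω : Opens E) : Subalgebra ℝ (Ω → ℝ) where
  carrier := {f | ContDiffOn ℝ ∞ (extz Ω f) Ω}
  mul_mem' := by
    intro f g hf hg
    refine (ContDiffOn.mul hf hg).congr ?_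
    intro x hx
    simp [extz_of_mem _ hx]
  add_mem' := by
    intro f g hf hg
    refine (ContDiffOn.add hf hg).congr ?_
    intro x hx
    simp [extz_of_mem _ hx]
  algebraMap_mem' := by
    intro r
    refine (contDiffOn_const (c := r)).congr ?_
    intro x hx
    simp [extz_of_mem _ hx]

/-- The algebra of smooth functions, as a type. -/
abbrev SF (Ω : Opens E) : Type _ := SFalg Ω

variable {Ω : Opens E}

/-- Restriction of a function smooth on `Ω`. -/
def SF.mk (f : E → ℝ) (hf : ContDiffOn ℝ ∞ f Ω) : SF Ω :=
  ⟨fun x => f x, hf.congr (extz_restrict f)⟩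

/-- Evaluation at a point. -/
def ev (x : Ω) : SF Ω →ₐ[ℝ] ℝ := (Pi.evalAlgHom ℝ (fun _ : Ω => ℝ) x).comp (SFalg Ω).val

lemma ev_mk (f : E → ℝ) (hf : ContDiffOn ℝ ∞ f Ω) (x : Ω) : ev x (SF.mk f hf) = f x := rfl

lemma SF.ext' {f g : SF Ω} (h : ∀ x, ev x f = ev x g) : f = g :=
  Subtype.ext (funext h)

/-- The underlying function on the whole space. -/
def SF.fn (f : SF Ω) : E → ℝ := extz Ω f.1

lemma SF.fn_apply (f : SF Ω) (x : Ω) : f.fn x = ev x f := extz_apply _ _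

lemma SF.contDiffOn (f : SF Ω) : ContDiffOn ℝ ∞ f.fn Ω := f.2

lemma SF.contDiffAt (f : SF Ω) (x : Ω) : ContDiffAt ℝ ∞ f.fn x :=
  f.2.contDiffAt (Ω.2.mem_nhds x.2)

lemma SF.differentiableAt (f : SF Ω) (x : Ω) : DifferentiableAt ℝ f.fn x :=
  (f.contDiffAt x).differentiableAt (by simp)

lemma SF.fn_eventuallyEq {f : SF Ω} {g : E → ℝ} (h : ∀ x : Ω, ev x f = g x) (x : Ω) :
    f.fn =ᶠ[nhds (x : E)] g := by
  filter_upwards [Ω.2.mem_nhds x.2] with y hy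
  exact (f.fn_apply ⟨y, hy⟩).trans (h ⟨y, hy⟩)

lemma SF.contDiffOn_fderiv (f : SF Ω) (e : E) :
    ContDiffOn ℝ ∞ (fun x => fderiv ℝ f.fn x e) Ω := by
  have := f.contDiffOn.fderiv_of_isOpen (m := ∞) Ω.2 (by simp)
  exact this.clm_apply contDiffOn_const

/-- Directional derivative as a derivation. -/
def DD (e : E) : Derivation ℝ (SF Ω) (SF Ω) :=
  Derivation.mk'
    { toFun := fun f => SF.mk (fun x => fderiv ℝ f.fn x e) (f.contDiffOn_fderiv e)
      map_add' := by
        intro f g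
        apply SF.ext'
        intro x
        rw [map_add, ev_mk, ev_mk, ev_mk]
        have : (f + g).fn =ᶠ[nhds (x : E)] f.fn + g.fn :=
          SF.fn_eventuallyEq (fun y => by simp [SF.fn_apply]) x
        rw [this.fderiv_eq, fderiv_add (f.differentiableAt x) (g.differentiableAt x)]
        rfl
      map_smul' := by
        intro r f
        apply SF.ext'
        intro x
        rw [RingHom.id_apply, map_smul, ev_mk, ev_mk]
        have : (r • f).fn =ᶠ[nhds (x : E)] r • f.fn :=
          SF.fn_eventuallyEq (fun y => by simp [SF.fn_apply]) x
        rw [this.fderiv_eq, fderiv_const_smul (f.differentiableAt x)]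
        rfl }
    (by
      intro f g
      apply SF.ext'
      intro x
      simp only [LinearMap.coe_mk, AddHom.coe_mk, smul_eq_mul, map_add, map_mul, ev_mk]
      have : (f * g).fn =ᶠ[nhds (x : E)] f.fn * g.fn :=
        SF.fn_eventuallyEq (fun y => by simp [SF.fn_apply]) x
      rw [this.fderiv_eq, fderiv_mul (f.differentiableAt x) (g.differentiableAt x)]
      simp [SF.fn_apply])

lemma ev_DD (e : E) (f : SF Ω) (x : Ω) : ev x (DD e f) = fderiv ℝ f.fn x e := rfl

lemma ev_DD_of_eq (e : E) (f : SF Ω) {g : E → ℝ} (h : ∀ x : Ω, ev x f = g x) (x : Ω) :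
    ev x (DD e f) = fderiv ℝ g x e := by
  rw [ev_DD, (SF.fn_eventuallyEq h x).fderiv_eq]

lemma ev_DD_mk (e : E) (f : E → ℝ) (hf : ContDiffOn ℝ ∞ f Ω) (x : Ω) :
    ev x (DD e (SF.mk f hf)) = fderiv ℝ f x e := ev_DD_of_eq e _ (fun _ => rfl) x

lemma ev_DD_DD (e e' : E) (f : SF Ω) (x : Ω) :
    ev x (DD e (DD e' f)) = fderiv ℝ (fderiv ℝ f.fn) x e e' := by
  rw [ev_DD_of_eq e (DD e' f) (g := fun y => fderiv ℝ f.fn y e') (fun y => rfl)]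
  have hd : DifferentiableAt ℝ (fderiv ℝ f.fn) x :=
    ((f.contDiffAt x).fderiv_right (m := 1) (by norm_cast)).differentiableAt (by simp)
  rw [fderiv_clm_apply hd (differentiableAt_const _)]
  simp

lemma DD_comm (e e' : E) (f : SF Ω) : DD e (DD e' f) = DD e' (DD e f) := by
  apply SF.ext'
  intro x
  rw [ev_DD_DD, ev_DD_DD]
  have := (f.contDiffAt x).isSymmSndFDerivAt (by
    rw [minSmoothness_of_isRCLikeNormedField]; exact WithTop.coe_le_coe.2 le_top)
  exact this _ _

lemma DD_sum {ι : Type*} (s : Finset ι) (c : ι → ℝ) (v : ι → E) (f : SF Ω) :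
    DD (∑ i ∈ s, c i • v i) f = ∑ i ∈ s, c i • DD (v i) f := by
  apply SF.ext'
  intro x
  rw [ev_DD]
  simp [map_sum, ev_DD]

/-- value along a line -/
lemma SF.hasDerivAt_line (f : SF Ω) (x : Ω) (e : E) (t : ℝ) (ht : (x : E) + t • e ∈ Ω) :
    HasDerivAt (fun s : ℝ => f.fn ((x : E) + s • e)) (ev ⟨_, ht⟩ (DD e f)) t := by
  have h1 : HasDerivAt (fun s : ℝ => (x : E) + s • e) e t := by
    simpa using ((hasDerivAt_id t).smul_const e).const_add (x : E)
  have h2 := (f.differentiableAt ⟨_, ht⟩).hasFDerivAt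
  exact h2.comp_hasDerivAt t h1

lemma SF.local_max_first (f : SF Ω) (x : Ω) (h : IsLocalMax f.fn x) (e : E) :
    ev x (DD e f) = 0 := by
  rw [ev_DD, h.fderiv_eq_zero]; rfl

lemma SF.local_max_second (f : SF Ω) (x : Ω) (h : IsLocalMax f.fn x) (e : E) :
    ev x (DD e (DD e f)) ≤ 0 := by
  by_contra hc
  push Not at hc
  set φ : ℝ → ℝ := fun s => f.fn ((x : E) + s • e) with hφ
  have hcont : Continuous (fun s : ℝ => (x : E) + s • e) := by fun_prop
  have hmem : ∀ᶠ s in nhds (0 : ℝ), (x : E) + s • e ∈ Ω := by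
    apply hcont.continuousAt.eventually_mem
    simpa using Ω.2.mem_nhds x.2
  have hd : deriv φ =ᶠ[nhds 0] fun s => (DD e f).fn ((x : E) + s • e) := by
    filter_upwards [hmem] with s hs
    rw [(f.hasDerivAt_line x e s hs).deriv, ← SF.fn_apply]
  have h0 : (x : E) + (0 : ℝ) • e ∈ Ω := by simp
  have hx0 : (⟨_, h0⟩ : Ω) = x := by ext; simp
  have hdd : deriv (deriv φ) 0 = ev x (DD e (DD e f)) := by
    rw [hd.deriv_eq, ((DD e f).hasDerivAt_line x e 0 h0).deriv, hx0]
  have hmax : IsLocalMax φ 0 := by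
    have h3 : Filter.Tendsto (fun s : ℝ => (x : E) + s • e) (nhds 0) (nhds (x : E)) := by
      simpa using hcont.tendsto 0
    filter_upwards [h3.eventually h] with s hs
    simpa [hφ] using hs
  have hmin : IsLocalMin φ 0 := by
    apply isLocalMin_of_deriv_deriv_pos (by rw [hdd]; exact hc) hmax.deriv_eq_zero
    exact (f.hasDerivAt_line x e 0 h0).continuousAt
  have hconst : φ =ᶠ[nhds 0] fun _ => φ 0 := by
    filter_upwards [hmax, hmin] with s h1 h2
    exact le_antisymm h1 h2
  have : deriv (deriv φ) 0 = 0 := by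
    rw [hconst.deriv.deriv_eq]; simp
  linarith

end SmoothRing

section RealAlg
variable {ι : Type*} [Fintype ι] [DecidableEq ι]

lemma sum3_swap12 (f : ι → ι → ι → ℝ) :
    ∑ i, ∑ j, ∑ k, f i j k = ∑ i, ∑ j, ∑ k, f j i k := Finset.sum_comm

lemma sum3_swap23 (f : ι → ι → ι → ℝ) :
    ∑ i, ∑ j, ∑ k, f i j k = ∑ i, ∑ j, ∑ k, f i k j :=
  Finset.sum_congr rfl fun _ _ => Finset.sum_comm

lemma sum3_swap13 (f : ι → ι → ι → ℝ) :
    ∑ i, ∑ j, ∑ k, f i j k = ∑ i, ∑ j, ∑ k, f k j i := by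
  rw [sum3_swap12, sum3_swap23, sum3_swap12]

/-- 4-index swaps -/
lemma sum4_swap12 (f : ι → ι → ι → ι → ℝ) :
    ∑ i, ∑ j, ∑ k, ∑ l, f i j k l = ∑ i, ∑ j, ∑ k, ∑ l, f j i k l := Finset.sum_comm

lemma sum4_swap23 (f : ι → ι → ι → ι → ℝ) :
    ∑ i, ∑ j, ∑ k, ∑ l, f i j k l = ∑ i, ∑ j, ∑ k, ∑ l, f i k j l :=
  Finset.sum_congr rfl fun _ _ => Finset.sum_comm

lemma sum4_swap34 (f : ι → ι → ι → ι → ℝ) :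
    ∑ i, ∑ j, ∑ k, ∑ l, f i j k l = ∑ i, ∑ j, ∑ k, ∑ l, f i j l k :=
  Finset.sum_congr rfl fun _ _ => Finset.sum_congr rfl fun _ _ => Finset.sum_comm

lemma sum4_swap24 (f : ι → ι → ι → ι → ℝ) :
    ∑ i, ∑ j, ∑ k, ∑ l, f i j k l = ∑ i, ∑ j, ∑ k, ∑ l, f i l k j := 
  Finset.sum_congr rfl fun _ _ => sum3_swap13 _

/-- The quadratic part of the second derivative, contracted with the identity metric. -/
lemma contract_six (t0 t1 t2 : ι → ι → ι → ℝ) (g1 g2 : ι → ι → ℝ)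
    (a0 : ∀ i j k, t0 i j k = t0 j i k) (b0 : ∀ i j k, t0 i j k = t0 i k j)
    (a1 : ∀ i j k, t1 i j k = t1 j i k) (b1 : ∀ i j k, t1 i j k = t1 i k j)
    (s1 : ∀ i j, g1 i j = g1 j i) 
    (δ : ι → ι → ℝ) (hδ : ∀ i j, δ i j = if i = j then 1 else 0) :
    ∑ i, ∑ j, ∑ k, ∑ a, ∑ b, ∑ c,
      (t2 i j k * t0 a b c * δ i a * δ j b * δ k c
      + t0 i j k * t2 a b c * δ i a * δ j b * δ k c
      + 2 * (t1 i j k * t1 a b c * δ i a * δ j b * δ k c)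
      + (t0 i j k * t0 a b c * g2 i a * δ j b * δ k c
        + t0 i j k * t0 a b c * δ i a * g2 j b * δ k c
        + t0 i j k * t0 a b c * δ i a * δ j b * g2 k c)
      + 2 * (t1 i j k * t0 a b c * g1 i a * δ j b * δ k c
        + t1 i j k * t0 a b c * δ i a * g1 j b * δ k c
        + t1 i j k * t0 a b c * δ i a * δ j b * g1 k c)
      + 2 * (t0 i j k * t1 a b c * g1 i a * δ j b * δ k c
        + t0 i j k * t1 a b c * δ i a * g1 j b * δ k c
        + t0 i j k * t1 a b c * δ i a * δ j b * g1 k c)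
      + 2 * (t0 i j k * t0 a b c * g1 i a * g1 j b * δ k c
        + t0 i j k * t0 a b c * g1 i a * δ j b * g1 k c
        + t0 i j k * t0 a b c * δ i a * g1 j b * g1 k c))
    = 2 * (∑ i, ∑ j, ∑ k, t2 i j k * t0 i j k) + 2 * (∑ i, ∑ j, ∑ k, t1 i j k * t1 i j k)
      + 12 * (∑ i, ∑ a, ∑ j, ∑ k, t1 i j k * t0 a j k * g1 i a)
      + 3 * (∑ i, ∑ a, ∑ j, ∑ k, t0 i j k * t0 a j k * g2 i a)
      + 6 * (∑ i, ∑ j, ∑ k, ∑ a, ∑ b, t0 i j k * t0 a b k * g1 i a * g1 j b) := by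
  simp only [Finset.sum_add_distrib, ← Finset.mul_sum, hδ, mul_ite, mul_one, mul_zero, ite_mul,
    zero_mul, Finset.sum_ite_eq, Finset.mem_univ, if_true, Finset.sum_ite_irrel,
    Finset.sum_const_zero]
  have e0 : ∑ i, ∑ j, ∑ k, t0 i j k * t2 i j k = ∑ i, ∑ j, ∑ k, t2 i j k * t0 i j k := by
    simp only [mul_comm]
  -- slot lemma
  have slot1 : ∀ (s r : ι → ι → ι → ℝ) (g : ι → ι → ℝ),
      ∑ i, ∑ j, ∑ k, ∑ a, s i j k * r a j k * g i a
        = ∑ i, ∑ a, ∑ j, ∑ k, s i j k * r a j k * g i a := by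
    intro s r g
    refine Finset.sum_congr rfl fun i _ => ?_
    rw [sum3_swap23, sum3_swap12]
  have slot2 : ∀ (s r : ι → ι → ι → ℝ) (g : ι → ι → ℝ),
      (∀ i j k, s i j k = s j i k) → (∀ i j k, r i j k = r j i k) →
      ∑ i, ∑ j, ∑ k, ∑ b, s i j k * r i b k * g j b
        = ∑ i, ∑ a, ∑ j, ∑ k, s i j k * r a j k * g i a := by
    intro s r g hs hr
    rw [← slot1, sum4_swap12]
    refine Finset.sum_congr rfl fun i _ => Finset.sum_congr rfl fun j _ =>
      Finset.sum_congr rfl fun k _ => Finset.sum_congr rfl fun b _ => ?_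
    rw [hs j i k, hr j b k]
  have slot3 : ∀ (s r : ι → ι → ι → ℝ) (g : ι → ι → ℝ),
      (∀ i j k, s i j k = s j i k) → (∀ i j k, r i j k = r j i k) →
      (∀ i j k, s i j k = s i k j) → (∀ i j k, r i j k = r i k j) →
      ∑ i, ∑ j, ∑ k, ∑ c, s i j k * r i j c * g k c
        = ∑ i, ∑ a, ∑ j, ∑ k, s i j k * r a j k * g i a := by
    intro s r g hs hr hs' hr'
    rw [← slot2 s r g hs hr, sum4_swap23]
    refine Finset.sum_congr rfl fun i _ => Finset.sum_congr rfl fun j _ =>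
      Finset.sum_congr rfl fun k _ => Finset.sum_congr rfl fun b _ => ?_
    rw [hs' i k j, hr' i k b]
  have flip : ∑ i, ∑ a, ∑ j, ∑ k, t0 i j k * t1 a j k * g1 i a
      = ∑ i, ∑ a, ∑ j, ∑ k, t1 i j k * t0 a j k * g1 i a := by
    rw [sum4_swap12]
    refine Finset.sum_congr rfl fun i _ => Finset.sum_congr rfl fun j _ =>
      Finset.sum_congr rfl fun k _ => Finset.sum_congr rfl fun b _ => ?_
    rw [s1 j i]; ring
  have c2 : ∑ i, ∑ j, ∑ k, ∑ a, ∑ c, t0 i j k * t0 a j c * g1 i a * g1 k c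
      = ∑ i, ∑ j, ∑ k, ∑ a, ∑ b, t0 i j k * t0 a b k * g1 i a * g1 j b := by
    refine Finset.sum_congr rfl fun i _ => ?_
    rw [Finset.sum_comm]
    refine Finset.sum_congr rfl fun j _ =>
      Finset.sum_congr rfl fun k _ => Finset.sum_congr rfl fun a _ =>
      Finset.sum_congr rfl fun b _ => ?_
    rw [b0 i k j, b0 a k b]
  have c3 : ∑ i, ∑ j, ∑ k, ∑ b, ∑ c, t0 i j k * t0 i b c * g1 j b * g1 k c
      = ∑ i, ∑ j, ∑ k, ∑ a, ∑ b, t0 i j k * t0 a b k * g1 i a * g1 j b := by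
    rw [← c2, Finset.sum_comm]
    refine Finset.sum_congr rfl fun i _ => Finset.sum_congr rfl fun j _ =>
      Finset.sum_congr rfl fun k _ => Finset.sum_congr rfl fun a _ =>
      Finset.sum_congr rfl fun b _ => ?_
    rw [a0 j i k, a0 j a b]
  rw [e0, slot1, slot1, slot1, slot2 _ _ _ a0 a0, slot2 _ _ _ a1 a0, slot2 _ _ _ a0 a1,
    slot3 _ _ _ a0 a0 b0 b0, slot3 _ _ _ a1 a0 b1 b0, slot3 _ _ _ a0 a1 b0 b1, flip, c2, c3]
  ring


/-- Completing squares in the Bochner identity. -/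
lemma bochner_squares (Q Y : ι → ι → ι → ι → ℝ)
    (q2 : ∀ i j k l, Q i j k l = Q i k j l) (q3 : ∀ i j k l, Q i j k l = Q i j l k)
    (y2 : ∀ i j k l, Y i j k l = Y i j l k) :
    0 ≤ (∑ i, ∑ j, ∑ k, ∑ l, Q i j k l * Q i j k l)
      - 3 * (∑ i, ∑ j, ∑ k, ∑ l, Q i j k l * Y i j k l)
      + 3 / 4 * (∑ i, ∑ j, ∑ k, ∑ l, Y i j k l * Y i j k l)
      + 3 / 2 * (∑ i, ∑ j, ∑ k, ∑ l, Y i j k l * Y i k j l) ∧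
    (∑ i, ∑ j, ∑ k, ∑ l, Y i j k l * Y i k j l) ≤ ∑ i, ∑ j, ∑ k, ∑ l, Y i j k l * Y i j k l := by
  have hsq : 0 ≤ ∑ i, ∑ j, ∑ k, ∑ l,
      (Q i j k l - 1 / 2 * (Y i j k l + Y i k j l + Y i l k j)) ^ 2 := Finset.sum_nonneg fun _ _ => Finset.sum_nonneg fun _ _ =>
      Finset.sum_nonneg fun _ _ => Finset.sum_nonneg fun _ _ => sq_nonneg _
  have hsq2 : 0 ≤ ∑ i, ∑ j, ∑ k, ∑ l, (Y i j k l - Y i k j l) ^ 2 := Finset.sum_nonneg fun _ _ => Finset.sum_nonneg fun _ _ =>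
      Finset.sum_nonneg fun _ _ => Finset.sum_nonneg fun _ _ => sq_nonneg _
  have e1 : ∀ i j k l, (Q i j k l - 1 / 2 * (Y i j k l + Y i k j l + Y i l k j)) ^ 2
      = Q i j k l * Q i j k l - Q i j k l * Y i j k l - Q i j k l * Y i k j l
        - Q i j k l * Y i l k j + 1 / 4 * (Y i j k l * Y i j k l) + 1 / 4 * (Y i k j l * Y i k j l)
        + 1 / 4 * (Y i l k j * Y i l k j) + 1 / 2 * (Y i j k l * Y i k j l)
        + 1 / 2 * (Y i j k l * Y i l k j) + 1 / 2 * (Y i k j l * Y i l k j) := by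
    intros; ring
  have e2 : ∀ i j k l, (Y i j k l - Y i k j l) ^ 2
      = Y i j k l * Y i j k l + Y i k j l * Y i k j l - 2 * (Y i j k l * Y i k j l) := by
    intros; ring
  have a1 : ∑ i, ∑ j, ∑ k, ∑ l, Q i j k l * Y i k j l
      = ∑ i, ∑ j, ∑ k, ∑ l, Q i j k l * Y i j k l := by
    rw [sum4_swap23]; simp only [← q2]
  have q4 : ∀ i j k l, Q i l k j = Q i j k l := by
    intro i j k l; rw [q2, q3, q2]
  have a2 : ∑ i, ∑ j, ∑ k, ∑ l, Q i j k l * Y i l k j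
      = ∑ i, ∑ j, ∑ k, ∑ l, Q i j k l * Y i j k l := by
    rw [sum4_swap24]; simp only [q4]
  have a3 : ∑ i, ∑ j, ∑ k, ∑ l, Y i k j l * Y i k j l
      = ∑ i, ∑ j, ∑ k, ∑ l, Y i j k l * Y i j k l := by
    rw [sum4_swap23]
  have a4 : ∑ i, ∑ j, ∑ k, ∑ l, Y i l k j * Y i l k j
      = ∑ i, ∑ j, ∑ k, ∑ l, Y i j k l * Y i j k l := by
    rw [sum4_swap24]
  have y4 : ∀ i j k l, Y i l k j = Y i l j k := fun i j k l => y2 i l k j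
  have a5 : ∑ i, ∑ j, ∑ k, ∑ l, Y i j k l * Y i l k j
      = ∑ i, ∑ j, ∑ k, ∑ l, Y i j k l * Y i k j l := by
    rw [sum4_swap34]
    refine Finset.sum_congr rfl fun i _ => Finset.sum_congr rfl fun j _ =>
      Finset.sum_congr rfl fun k _ => Finset.sum_congr rfl fun l _ => ?_
    rw [y2 i j l k, y2 i k l j]
  have a6 : ∑ i, ∑ j, ∑ k, ∑ l, Y i k j l * Y i l k j
      = ∑ i, ∑ j, ∑ k, ∑ l, Y i j k l * Y i k j l := by
    rw [← a5, sum4_swap23]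
    refine Finset.sum_congr rfl fun i _ => Finset.sum_congr rfl fun j _ =>
      Finset.sum_congr rfl fun k _ => Finset.sum_congr rfl fun l _ => ?_
    rw [y2 i l j k]
  simp only [e1, Finset.sum_add_distrib, Finset.sum_sub_distrib, ← Finset.mul_sum] at hsq
  simp only [e2, Finset.sum_add_distrib, Finset.sum_sub_distrib, ← Finset.mul_sum] at hsq2
  rw [a1, a2, a3, a4, a5, a6] at hsq
  rw [a3] at hsq2
  constructor <;> linarith

lemma trace_sq_le (S : ι → ι → ℝ) :
    (∑ i, S i i) ^ 2 ≤ (Fintype.card ι) * ∑ i, ∑ j, S i j * S i j := by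
  calc (∑ i, S i i) ^ 2 ≤ (Finset.univ.card : ℝ) * ∑ i, S i i ^ 2 := sq_sum_le_card_mul_sum_sq
    _ ≤ _ := by
      rw [Finset.card_univ]
      refine mul_le_mul_of_nonneg_left ?_ (by positivity)
      refine Finset.sum_le_sum fun i _ => ?_
      rw [sq]
      exact Finset.single_le_sum (f := fun j => S i j * S i j)
        (fun j _ => mul_self_nonneg _) (Finset.mem_univ i)

lemma sum22 (f : ι → ι → ι → ι → ℝ) :
    ∑ i, ∑ j, ∑ k, ∑ l, f i j k l = ∑ k, ∑ l, ∑ i, ∑ j, f i j k l := by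
  rw [sum4_swap23, sum4_swap12, sum4_swap34, sum4_swap23]

lemma bochner_real (T : ι → ι → ι → ℝ) (Q : ι → ι → ι → ι → ℝ) (V : ι → ι → ι → ℝ)
    (t1 : ∀ i j k, T i j k = T j i k) (t2 : ∀ i j k, T i j k = T i k j)
    (q1 : ∀ i j k l, Q i j k l = Q j i k l) (q2 : ∀ i j k l, Q i j k l = Q i k j l)
    (q3 : ∀ i j k l, Q i j k l = Q i j l k)
    (hQ : ∀ i j, ∑ l, Q l l i j = 2 * (if i = j then 1 else 0) + ∑ a, ∑ b, T i a b * T j a b)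
    (hV : ∀ i j k, V i j k = 2 * T i j k
      + ∑ a, ∑ b, (T k a b * Q i j a b + T j a b * Q i k a b + T i a b * Q j k a b)
      - ∑ a, ∑ b, (∑ c, (T j a c * T k c b + T k a c * T j c b)) * T i a b)
    (Lu u : ℝ) (hu : u = ∑ i, ∑ j, ∑ k, T i j k * T i j k)
    (hLu : Lu = 2 * (∑ i, ∑ j, ∑ k, V i j k * T i j k)
      + 2 * (∑ l, ∑ i, ∑ j, ∑ k, Q l i j k * Q l i j k)
      - 12 * (∑ l, ∑ i, ∑ a, ∑ j, ∑ k, Q l i j k * T a j k * T l i a)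
      + 3 * (∑ l, ∑ i, ∑ a, ∑ j, ∑ k,
          T i j k * T a j k * (2 * (∑ c, T l i c * T l c a) - Q l l i a))
      + 6 * (∑ l, ∑ i, ∑ j, ∑ k, ∑ a, ∑ b, T i j k * T a b k * T l i a * T l j b)) :
    u * (u - 4 * Fintype.card ι) ≤ 2 * Fintype.card ι * Lu := by
  set Y : ι → ι → ι → ι → ℝ := fun i j k l => ∑ m, T i j m * T k l m with hY
  set S : ι → ι → ℝ := fun i a => ∑ j, ∑ k, T i j k * T a j k with hS
  have y2 : ∀ i j k l, Y i j k l = Y i j l k := by intro i j k l; simp only [hY, t1 k l]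
  have tr3 : ∀ i j k, T i j k = T j k i := by intro i j k; rw [t1, t2]
  obtain ⟨sq1, sq2⟩ := bochner_squares Q Y q2 q3 y2
  have tr := trace_sq_le S
  have hSu : ∑ i, S i i = u := by rw [hu]
  rw [hSu] at tr
  have hSS : ∑ i, ∑ j, ∑ k, ∑ l, Y i j k l * Y i j k l = ∑ i, ∑ j, S i j * S i j := by
    have h1 : ∀ i j, ∑ k, ∑ l, Y i j k l * Y i j k l
        = ∑ m, ∑ n, T i j m * T i j n * S m n := by
      intro i j
      simp only [hY, Finset.sum_mul_sum]
      rw [sum22]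
      refine Finset.sum_congr rfl fun m _ => Finset.sum_congr rfl fun n _ => ?_
      simp only [hS, Finset.mul_sum]
      refine Finset.sum_congr rfl fun k _ => Finset.sum_congr rfl fun l _ => ?_
      rw [tr3 m, tr3 n]; ring
    simp only [h1]
    rw [sum22]
    refine Finset.sum_congr rfl fun m _ => Finset.sum_congr rfl fun n _ => ?_
    simp only [← Finset.sum_mul]
    congr 1
    simp only [hS]
    refine Finset.sum_congr rfl fun k _ => Finset.sum_congr rfl fun l _ => ?_
    rw [tr3 m, tr3 n]
  have c2 : ∑ l, ∑ i, ∑ a, ∑ j, ∑ k, Q l i j k * T a j k * T l i a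
      = ∑ i, ∑ j, ∑ k, ∑ l, Q i j k l * Y i j k l := by
    refine Finset.sum_congr rfl fun l _ => Finset.sum_congr rfl fun i _ => ?_
    rw [sum3_swap12, sum3_swap23]
    refine Finset.sum_congr rfl fun j _ => Finset.sum_congr rfl fun k _ => ?_
    simp only [hY, Finset.mul_sum]
    refine Finset.sum_congr rfl fun a _ => ?_
    rw [tr3 a j k]; ring
  have c4 : ∑ l, ∑ i, ∑ j, ∑ k, ∑ a, ∑ b, T i j k * T a b k * T l i a * T l j b
      = ∑ i, ∑ j, ∑ k, ∑ l, Y i j k l * Y i k j l := by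
    rw [Finset.sum_comm]
    refine Finset.sum_congr rfl fun i _ => ?_
    rw [Finset.sum_comm]
    refine Finset.sum_congr rfl fun j _ => ?_
    simp only [hY, Finset.sum_mul_sum]
    rw [sum22]
    refine Finset.sum_congr rfl fun a _ => Finset.sum_congr rfl fun b _ => ?_
    rw [Finset.sum_comm]
    refine Finset.sum_congr rfl fun k _ => Finset.sum_congr rfl fun l _ => ?_
    rw [tr3 l i a, tr3 l j b]; ring
  have c3 : ∑ l, ∑ i, ∑ a, ∑ j, ∑ k,
          T i j k * T a j k * (2 * (∑ c, T l i c * T l c a) - Q l l i a)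
      = (∑ i, ∑ j, S i j * S i j) - 2 * u := by
    simp only [← Finset.sum_mul]
    have h1 : ∀ i a, ∑ l, (2 * (∑ c, T l i c * T l c a) - Q l l i a)
        = S i a - 2 * (if i = a then 1 else 0) := by
      intro i a
      rw [Finset.sum_sub_distrib, hQ, ← Finset.mul_sum]
      have : ∑ l, ∑ c, T l i c * T l c a = S i a := by
        simp only [hS]
        refine Finset.sum_congr rfl fun l _ => Finset.sum_congr rfl fun c _ => ?_
        rw [t1 l i c, t2 l c a, t1 l a c]
      rw [this]
      simp only [hS]; ring
    rw [sum3_swap12, sum3_swap23]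
    simp only [← Finset.mul_sum, h1]
    have h2 : ∀ i a, S i a * (S i a - 2 * (if i = a then 1 else 0))
        = S i a * S i a - if i = a then 2 * S i a else 0 := by
      intro i a; split_ifs <;> ring
    have h3 : ∀ i a, (∑ j, ∑ k, T i j k * T a j k) = S i a := fun _ _ => rfl
    simp only [h3, h2, Finset.sum_sub_distrib, Finset.sum_ite_eq, Finset.mem_univ, if_true,
      ← Finset.mul_sum, hSu]
  have c1 : ∑ i, ∑ j, ∑ k, V i j k * T i j k
      = 2 * u + 3 * (∑ i, ∑ j, ∑ k, ∑ l, Q i j k l * Y i j k l)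
        - 2 * (∑ i, ∑ j, ∑ k, ∑ l, Y i j k l * Y i k j l) := by
    have p1 : ∑ i, ∑ j, ∑ k, (∑ a, ∑ b, T k a b * Q i j a b) * T i j k
        = ∑ i, ∑ j, ∑ k, ∑ l, Q i j k l * Y i j k l := by
      refine Finset.sum_congr rfl fun i _ => Finset.sum_congr rfl fun j _ => ?_
      simp only [hY, Finset.mul_sum, Finset.sum_mul]
      rw [sum3_swap12, sum3_swap23]
      refine Finset.sum_congr rfl fun a _ => Finset.sum_congr rfl fun b _ =>
        Finset.sum_congr rfl fun k _ => ?_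
      rw [tr3 k a b]; ring
    have p2 : ∑ i, ∑ j, ∑ k, (∑ a, ∑ b, T j a b * Q i k a b) * T i j k
        = ∑ i, ∑ j, ∑ k, ∑ l, Q i j k l * Y i j k l := by
      rw [sum3_swap23, ← p1]
      refine Finset.sum_congr rfl fun i _ => Finset.sum_congr rfl fun j _ =>
        Finset.sum_congr rfl fun k _ => ?_
      rw [t2 i k j]
    have p3 : ∑ i, ∑ j, ∑ k, (∑ a, ∑ b, T i a b * Q j k a b) * T i j k
        = ∑ i, ∑ j, ∑ k, ∑ l, Q i j k l * Y i j k l := by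
      rw [← p1, sum3_swap13]
      refine Finset.sum_congr rfl fun i _ => Finset.sum_congr rfl fun j _ =>
        Finset.sum_congr rfl fun k _ => ?_
      simp only [q1 j i]
      rw [t2 k j i, tr3 k i j]
    have z1 : ∑ i, ∑ j, ∑ k, (∑ a, ∑ b, (∑ c, T j a c * T k c b) * T i a b) * T i j k
        = ∑ i, ∑ j, ∑ k, ∑ l, Y i j k l * Y i k j l := by
      rw [sum3_swap12, sum3_swap23]
      refine Finset.sum_congr rfl fun j _ => Finset.sum_congr rfl fun k _ => ?_
      simp only [Finset.sum_mul]
      rw [sum4_swap12, sum4_swap23]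
      refine Finset.sum_congr rfl fun a _ => Finset.sum_congr rfl fun b _ => ?_
      simp only [hY, Finset.sum_mul_sum]
      refine Finset.sum_congr rfl fun i _ => Finset.sum_congr rfl fun c _ => ?_
      rw [tr3 i a b, tr3 i j k, t2 k c b]; ring
    have z2 : ∑ i, ∑ j, ∑ k, (∑ a, ∑ b, (∑ c, T k a c * T j c b) * T i a b) * T i j k
        = ∑ i, ∑ j, ∑ k, ∑ l, Y i j k l * Y i k j l := by
      rw [sum3_swap23, ← z1]
      refine Finset.sum_congr rfl fun i _ => Finset.sum_congr rfl fun j _ =>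
        Finset.sum_congr rfl fun k _ => ?_
      rw [t2 i k j]
    simp only [hV, Finset.sum_add_distrib, add_mul, sub_mul, Finset.sum_sub_distrib]
    simp only [add_mul, mul_assoc, ← Finset.mul_sum, Finset.sum_add_distrib] at p1 p2 p3 z1 z2 ⊢
    rw [p1, p2, p3, z1, z2, hu]
    ring
  rw [c1, c2, c3, c4] at hLu
  rw [hSS] at sq1 sq2
  have hN : (0:ℝ) ≤ Fintype.card ι := by positivity
  have h2 : (∑ i, ∑ j, S i j * S i j) / 2 - 2 * u ≤ Lu := by linarith
  nlinarith [mul_le_mul_of_nonneg_left h2 hN]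

end RealAlg

section RealAlg2
variable {ι : Type*} [Fintype ι] [DecidableEq ι]

/-- model cubic form -/
def modelB (N : ℝ) (ξ : ι → ℝ) (i j k : ι) : ℝ :=
  -(2 / N) * (ξ i * (if j = k then 1 else 0) + ξ j * (if i = k then 1 else 0)
    + ξ k * (if i = j then 1 else 0)) + 4 / N ^ 2 * (ξ i * ξ j * ξ k)

lemma model_pair (N : ℝ) (hN : 0 < N) (hcard : (Fintype.card ι : ℝ) = N)
    (T : ι → ι → ι → ℝ) (ξ : ι → ℝ)
    (t1 : ∀ i j k, T i j k = T j i k) (t2 : ∀ i j k, T i j k = T i k j)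
    (hT : ∀ j k, ∑ i, ξ i * T i j k = -2 * (if j = k then 1 else 0))
    (hξ : ∑ i, ξ i * ξ i = N) :
    ∑ i, ∑ j, ∑ k, T i j k * modelB N ξ i j k = 12 - 8 / N := by
  have c1 : ∑ i, ∑ j, ξ i * T i j j = -2 * N := by
    rw [Finset.sum_comm]
    simp [hT, hcard]; ring
  have c2 : ∑ i, ∑ j, ξ j * T i j i = -2 * N := by
    rw [Finset.sum_comm, ← c1]
    refine Finset.sum_congr rfl fun i _ => Finset.sum_congr rfl fun j _ => ?_
    rw [t1]
  have c3 : ∑ i, ∑ k, ξ k * T i i k = -2 * N := by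
    rw [← c2]
    refine Finset.sum_congr rfl fun i _ => Finset.sum_congr rfl fun j _ => ?_
    rw [t2]
  have c4 : ∑ i, ∑ j, ∑ k, T i j k * (ξ i * ξ j * ξ k) = -2 * N := by
    have : ∀ i j k, T i j k * (ξ i * ξ j * ξ k) = (ξ i * T i j k) * (ξ j * ξ k) := by
      intros; ring
    simp only [this]
    rw [sum3_swap12, sum3_swap23]
    simp only [← Finset.sum_mul, hT]
    simp [← Finset.mul_sum, hξ, mul_assoc]
  have e : ∀ i j k, T i j k * modelB N ξ i j k
      = -(2 / N) * (if j = k then ξ i * T i j k else 0)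
        + -(2 / N) * (if i = k then ξ j * T i j k else 0)
        + -(2 / N) * (if i = j then ξ k * T i j k else 0)
        + 4 / N ^ 2 * (T i j k * (ξ i * ξ j * ξ k)) := by
    intro i j k
    unfold modelB
    split_ifs <;> ring
  simp only [e, Finset.sum_add_distrib, ← Finset.mul_sum, c4]
  have d3 : ∑ i, ∑ j, ∑ k, (if i = j then ξ k * T i j k else 0) = ∑ i, ∑ k, ξ k * T i i k := by
    refine Finset.sum_congr rfl fun i _ => ?_
    rw [Finset.sum_comm]
    simp
  rw [d3, c3]
  simp only [Finset.sum_ite_eq, Finset.mem_univ, if_true, c1, c2]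
  field_simp
  ring

lemma lower_real (N : ℝ) (hN : 0 < N) (hcard : (Fintype.card ι : ℝ) = N)
    (T : ι → ι → ι → ℝ) (ξ : ι → ℝ)
    (t1 : ∀ i j k, T i j k = T j i k) (t2 : ∀ i j k, T i j k = T i k j)
    (hT : ∀ j k, ∑ i, ξ i * T i j k = -2 * (if j = k then 1 else 0))
    (hξ : ∑ i, ξ i * ξ i = N) :
    12 - 8 / N ≤ ∑ i, ∑ j, ∑ k, T i j k * T i j k := by
  have h1 := model_pair N hN hcard T ξ t1 t2 hT hξ
  have h2 := model_pair N hN hcard (modelB N ξ) ξ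
    (by intro i j k; unfold modelB; simp only [eq_comm (a := j) (b := i)]; ring)
    (by intro i j k; unfold modelB; simp only [eq_comm (a := k) (b := j)]; ring)
    (by
      intro j k
      have e : ∀ i, ξ i * modelB N ξ i j k
        = -(2 / N) * ((ξ i * ξ i) * (if j = k then 1 else 0))
          + -(2 / N) * (if i = k then ξ i * ξ j else 0)
          + -(2 / N) * (if i = j then ξ i * ξ k else 0)
          + 4 / N ^ 2 * ((ξ i * ξ i) * (ξ j * ξ k)) := by
        intro i; unfold modelB; split_ifs <;> ring
      simp only [e, Finset.sum_add_distrib, ← Finset.mul_sum, ← Finset.sum_mul, hξ]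
      simp only [Finset.sum_ite_eq', Finset.mem_univ, if_true]
      field_simp
      ring) hξ
  have h3 : 0 ≤ ∑ i, ∑ j, ∑ k, (T i j k - modelB N ξ i j k) ^ 2 :=
    Finset.sum_nonneg fun _ _ => Finset.sum_nonneg fun _ _ =>
      Finset.sum_nonneg fun _ _ => sq_nonneg _
  have e : ∀ i j k, (T i j k - modelB N ξ i j k) ^ 2
      = T i j k * T i j k - 2 * (T i j k * modelB N ξ i j k)
        + modelB N ξ i j k * modelB N ξ i j k := by intros; ring
  simp only [e, Finset.sum_add_distrib, Finset.sum_sub_distrib, ← Finset.mul_sum] at h3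
  linarith

lemma grad_scalar (N p h AA q : ℝ) (hN : 1 ≤ N) (hp : 0 < p) (hh : 0 ≤ h)
    (hq : q = p - 1 / N)
    (h1 : ((h + 2) * p - 2) ^ 2 ≤
      N * (AA - 2 * (h + 2) * (2 * p ^ 2 + h * p * q) + (h + 2) ^ 2 * p ^ 2))
    (h2 : (h ^ 2 - h ^ 2 / (2 * N)) * q * p + h * (p - 1) * p - 4 * h * p * q
      - 2 * h ^ 2 * p * q + AA - 2 * p - 2 * p ^ 2 ≤ 0) : p ≤ 5 := by
  by_contra hc
  push Not at hc
  have hN0 : (0:ℝ) < N := by linarith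
  obtain ⟨r, hr⟩ : ∃ r, r = 1 / N := ⟨_, rfl⟩
  have hr0 : 0 < r := by rw [hr]; positivity
  have hr1 : r ≤ 1 := by rw [hr, div_le_one hN0]; exact hN
  have hNr : N * r = 1 := by rw [hr]; field_simp
  have e1 : h ^ 2 / (2 * N) = h ^ 2 * r / 2 := by rw [hr]; field_simp
  rw [e1] at h2
  rw [← hr] at hq
  have h3 : r * ((h + 2) * p - 2) ^ 2 ≤
      (AA - 2 * (h + 2) * (2 * p ^ 2 + h * p * q) + (h + 2) ^ 2 * p ^ 2) := by
    have := mul_le_mul_of_nonneg_left h1 hr0.le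
    rw [← mul_assoc, mul_comm r N, hNr, one_mul] at this
    exact this
  subst hq
  have h4 : p * (p * (2 + h + r * (h + 2) ^ 2 - h ^ 2 * r / 2)) ≤
      p * (h ^ 2 * r + 4 * h * r + 8 * r + 2 + h - h ^ 2 * r ^ 2 / 2) := by
    nlinarith
  have h5 := le_of_mul_le_mul_left h4 hp
  have h6 : 5 * (2 + h + r * (h + 2) ^ 2 - h ^ 2 * r / 2)
      < p * (2 + h + r * (h + 2) ^ 2 - h ^ 2 * r / 2) := by
    apply mul_lt_mul_of_pos_right hc
    have : 0 ≤ h ^ 2 * r := by positivity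
    have : 0 ≤ h * r := by positivity
    nlinarith
  have : 0 ≤ h ^ 2 * r := by positivity
  have : 0 ≤ h * r := by positivity
  have : 0 ≤ h ^ 2 * r ^ 2 := by positivity
  have : h * r ≤ h := by nlinarith
  nlinarith

lemma grad_real (N p h q : ℝ) (hN : 1 ≤ N) (hcard : (Fintype.card ι : ℝ) = N) (hp : 0 < p)
    (hh : 0 ≤ h) (lam ξ : ι → ℝ) (A : ι → ι → ℝ)
    (hlam : ∑ i, lam i * lam i = p) (hlx : ∑ i, lam i * ξ i = 1)
    (htr : ∑ i, A i i = -2) (hq : q = p - 1 / N)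
    (h1 : ∀ l, ∑ j, A l j * lam j = -2 * p * lam l - h * p * (lam l - ξ l / N))
    (h2 : (h ^ 2 - h ^ 2 / (2 * N)) * q * p + h * (p - 1) * p - 4 * h * p * q
      - 2 * h ^ 2 * p * q + (∑ i, ∑ j, A i j * A i j) - 2 * p - 2 * p ^ 2 ≤ 0) : p ≤ 5 := by
  refine grad_scalar N p h _ q hN hp hh hq ?_ h2
  have hAl : ∑ i, ∑ j, A i j * (lam i * lam j) = -(2 * p ^ 2 + h * p * q) := by
    have e : ∀ i, ∑ j, A i j * (lam i * lam j)
        = -2 * p * (lam i * lam i) - h * p * (lam i * lam i) + h * p / N * (lam i * ξ i) := by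
      intro i
      have : ∀ j, A i j * (lam i * lam j) = lam i * (A i j * lam j) := by intros; ring
      simp only [this, ← Finset.mul_sum, h1]
      ring
    simp only [e, Finset.sum_add_distrib, Finset.sum_sub_distrib, ← Finset.mul_sum, hlam, hlx, hq]
    ring
  have hll : ∑ i, ∑ j, (lam i * lam j) * (lam i * lam j) = p ^ 2 := by
    have : ∀ i j, (lam i * lam j) * (lam i * lam j) = (lam i * lam i) * (lam j * lam j) := by
      intros; ring
    simp only [this, ← Finset.mul_sum, ← Finset.sum_mul, hlam]
    ring
  have := trace_sq_le (fun i j => A i j + (h + 2) * (lam i * lam j))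
  simp only [hcard] at this
  have e : ∀ i j, (A i j + (h + 2) * (lam i * lam j)) * (A i j + (h + 2) * (lam i * lam j))
      = A i j * A i j + 2 * (h + 2) * (A i j * (lam i * lam j))
        + (h + 2) ^ 2 * ((lam i * lam j) * (lam i * lam j)) := by intros; ring
  simp only [e, Finset.sum_add_distrib, ← Finset.mul_sum, htr, hlam, hAl, hll] at this
  linarith

end RealAlg2

section PotAlg
variable {A : Type*} [CommRing A] [Algebra ℝ A] {ι : Type*} [Fintype ι] [DecidableEq ι]

/-- Algebraic data of a potential at a point in an orthonormal frame. -/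
structure Pot (D : ι → Derivation ℝ A A) (e : A →ₐ[ℝ] ℝ) (F : A) (G : ι → ι → A) : Prop where
  comm : ∀ i j a, D i (D j a) = D j (D i a)
  inv : ∀ i j, ∑ a, G i a * D a (D j F) = if i = j then 1 else 0
  tr : ∀ k, ∑ a, ∑ b, G a b * D k (D a (D b F)) = D k F + D k F
  on : ∀ i j, e (D i (D j F)) = if i = j then 1 else 0

variable {D : ι → Derivation ℝ A A} {e : A →ₐ[ℝ] ℝ} {F : A} {G : ι → ι → A}

lemma deriv_ite (d : Derivation ℝ A A) (p : Prop) [Decidable p] :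
    d (if p then (1 : A) else 0) = 0 := by
  split_ifs <;> simp

/-- second derivative of the product of five -/
lemma deriv_prod5 (d : Derivation ℝ A A) (x y p q r : A) :
    e (d (d (x * y * p * q * r))) =
      e (d (d x)) * e y * e p * e q * e r + e x * e (d (d y)) * e p * e q * e r
      + 2 * (e (d x) * e (d y) * e p * e q * e r)
      + (e x * e y * e (d (d p)) * e q * e r + e x * e y * e p * e (d (d q)) * e r
        + e x * e y * e p * e q * e (d (d r)))
      + 2 * (e (d x) * e y * e (d p) * e q * e r + e (d x) * e y * e p * e (d q) * e r
        + e (d x) * e y * e p * e q * e (d r))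
      + 2 * (e x * e (d y) * e (d p) * e q * e r + e x * e (d y) * e p * e (d q) * e r
        + e x * e (d y) * e p * e q * e (d r))
      + 2 * (e x * e y * e (d p) * e (d q) * e r + e x * e y * e (d p) * e q * e (d r)
        + e x * e y * e p * e (d q) * e (d r)) := by
  simp only [Derivation.leibniz, smul_eq_mul, map_add, map_mul]
  ring

namespace Pot

lemma eG (h : Pot D e F G) (i j : ι) : e (G i j) = if i = j then 1 else 0 := by
  have := congrArg e (h.inv i j)
  simp only [map_sum, map_mul, h.on, mul_ite, mul_one, mul_zero, Finset.sum_ite_eq',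
    Finset.mem_univ, if_true] at this
  rw [this]; split_ifs <;> simp

lemma eDG (h : Pot D e F G) (l i j : ι) : e (D l (G i j)) = - e (D l (D i (D j F))) := by
  have := congrArg (fun z => e (D l z)) (h.inv i j)
  simp only [map_sum, Derivation.leibniz, smul_eq_mul, map_add, map_mul, h.on, h.eG,
    deriv_ite, map_zero, Finset.sum_add_distrib, ite_mul, one_mul, zero_mul,
    Finset.sum_ite_eq, Finset.sum_ite_eq', Finset.mem_univ, if_true] at this
  linarith

lemma eDDG (h : Pot D e F G) (m l i j : ι) : e (D m (D l (G i j))) =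
    ∑ k, (e (D l (D i (D k F))) * e (D m (D k (D j F)))
      + e (D m (D i (D k F))) * e (D l (D k (D j F)))) - e (D m (D l (D i (D j F)))) := by
  have := congrArg (fun z => e (D m (D l z))) (h.inv i j)
  simp only [map_sum, Derivation.leibniz, smul_eq_mul, map_add, map_mul, h.on, h.eG, h.eDG,
    deriv_ite, map_zero, Finset.sum_add_distrib, ite_mul, one_mul, zero_mul,
    Finset.sum_ite_eq, Finset.sum_ite_eq', Finset.mem_univ, if_true] at this
  simp only [Finset.sum_add_distrib, mul_neg, neg_mul, Finset.sum_neg_distrib] at this ⊢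
  have c : ∀ k, e (D m (D k (D j F))) * e (D l (D i (D k F)))
    = e (D l (D i (D k F))) * e (D m (D k (D j F))) := fun _ => mul_comm _ _
  have c' : ∀ k, e (D l (D k (D j F))) * e (D m (D i (D k F)))
    = e (D m (D i (D k F))) * e (D l (D k (D j F))) := fun _ => mul_comm _ _
  simp only [c, c'] at this
  linarith

lemma etr (h : Pot D e F G) (k : ι) : ∑ a, e (D k (D a (D a F))) = 2 * e (D k F) := by
  have := congrArg e (h.tr k)
  rw [two_mul]
  simpa only [map_sum, map_mul, map_add, h.eG, ite_mul, one_mul, zero_mul,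
    Finset.sum_ite_eq, Finset.mem_univ, if_true] using this

lemma etr1 (h : Pot D e F G) (l k : ι) : ∑ a, e (D l (D k (D a (D a F)))) = 2 * (if l = k then 1 else 0)
    + ∑ a, ∑ b, e (D l (D a (D b F))) * e (D k (D a (D b F))) := by
  have := congrArg (fun z => e (D l z)) (h.tr k)
  simp only [map_sum, Derivation.leibniz, smul_eq_mul, map_add, map_mul, map_ofNat, h.eG, h.eDG,
    ite_mul, one_mul, zero_mul, Finset.sum_add_distrib, h.on, mul_neg, neg_mul,
    Finset.sum_neg_distrib, Finset.sum_ite_eq, Finset.mem_univ, if_true] at this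
  have c : ∀ a b, e (D k (D a (D b F))) * e (D l (D a (D b F)))
    = e (D l (D a (D b F))) * e (D k (D a (D b F))) := fun _ _ => mul_comm _ _
  simp only [c] at this
  linarith

lemma etr2 (h : Pot D e F G) (m l k : ι) : ∑ a, e (D m (D l (D k (D a (D a F))))) = 2 * e (D m (D l (D k F)))
    + ∑ a, ∑ b, (e (D m (D a (D b F))) * e (D l (D k (D a (D b F))))
      + e (D l (D a (D b F))) * e (D m (D k (D a (D b F))))
      + e (D k (D a (D b F))) * e (D m (D l (D a (D b F)))))
    - ∑ a, ∑ b, (∑ c, (e (D l (D a (D c F))) * e (D m (D c (D b F)))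
      + e (D m (D a (D c F))) * e (D l (D c (D b F))))) * e (D k (D a (D b F))) := by
  have := congrArg (fun z => e (D m (D l z))) (h.tr k)
  simp only [map_sum, Derivation.leibniz, smul_eq_mul, map_add, map_mul, map_ofNat, h.eG, h.eDG,
    h.eDDG, mul_sub, Finset.sum_sub_distrib,
    ite_mul, one_mul, zero_mul, Finset.sum_add_distrib, h.on, mul_neg, neg_mul,
    Finset.sum_neg_distrib, Finset.sum_ite_eq, Finset.mem_univ, if_true] at this
  simp only [Finset.sum_add_distrib, add_mul]
  simp only [mul_add, Finset.sum_add_distrib] at this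
  have c : ∀ (x y : ι → ι → ℝ), ∑ a, ∑ b, x a b * y a b = ∑ a, ∑ b, y a b * x a b := by
    intro x y; simp only [mul_comm]
  rw [c (fun a b => ∑ k, e (D l (D a (D k F))) * e (D m (D k (D b F)))),
    c (fun a b => ∑ k, e (D m (D a (D k F))) * e (D l (D k (D b F))))]
  rw [c (fun a b => e (D l (D k (D a (D b F)))))] at this
  linarith

lemma t1 (h : Pot D e F G) (i j k : ι) : e (D i (D j (D k F))) = e (D j (D i (D k F))) := by rw [h.comm]
lemma t2 (h : Pot D e F G) (i j k : ι) : e (D i (D j (D k F))) = e (D i (D k (D j F))) := by rw [h.comm j]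

lemma bochner (h : Pot D e F G) :
    let u : A := ∑ i, ∑ j, ∑ k, ∑ a, ∑ b, ∑ c,
      D i (D j (D k F)) * D a (D b (D c F)) * G i a * G j b * G k c
    e u = ∑ i, ∑ j, ∑ k, e (D i (D j (D k F))) * e (D i (D j (D k F))) ∧
    e u * (e u - 4 * Fintype.card ι) ≤ 2 * Fintype.card ι * ∑ l, e (D l (D l u)) := by
  intro u
  have hu : e u = ∑ i, ∑ j, ∑ k, e (D i (D j (D k F))) * e (D i (D j (D k F))) := by
    simp only [u, map_sum, map_mul, h.eG, mul_ite, mul_one, mul_zero, ite_mul,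
      zero_mul, Finset.sum_ite_eq, Finset.mem_univ, if_true, Finset.sum_ite_irrel,
      Finset.sum_const_zero]
  refine ⟨hu, ?_⟩
  refine bochner_real (fun i j k => e (D i (D j (D k F)))) (fun l i j k => e (D l (D i (D j (D k F)))))
    (fun i j k => ∑ l, e (D l (D l (D i (D j (D k F)))))) h.t1 h.t2
    (fun i j k l => by rw [h.comm]) (fun i j k l => by rw [h.comm j]) (fun i j k l => by rw [h.comm k])
    ?_ ?_ _ _ hu ?_
  · intro i j
    rw [← h.etr1 i j]
    refine Finset.sum_congr rfl fun a _ => ?_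
    rw [h.comm a i, h.comm a j, h.comm a i, h.comm a j]
  · intro i j k
    have := h.etr2 k j i
    have e1 : ∀ l, e (D l (D l (D i (D j (D k F))))) = e (D k (D j (D i (D l (D l F))))) := by
      intro l
      rw [h.comm j k, h.comm i k, h.comm l k, h.comm l k, h.comm i j, h.comm l j, h.comm l j,
        h.comm l i, h.comm l i]
    simp only [e1]
    rw [this]
    have e2 : e (D k (D j (D i F))) = e (D i (D j (D k F))) := by
      rw [h.comm k j, h.comm k i, h.comm j i]
    rw [e2]
    simp only [h.comm j i, h.comm k i, h.comm k j]
  · have hl : ∀ l, e (D l (D l u)) =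
        2 * (∑ i, ∑ j, ∑ k, e (D l (D l (D i (D j (D k F))))) * e (D i (D j (D k F))))
      + 2 * (∑ i, ∑ j, ∑ k, e (D l (D i (D j (D k F)))) * e (D l (D i (D j (D k F)))))
      + 12 * (∑ i, ∑ a, ∑ j, ∑ k, e (D l (D i (D j (D k F)))) * e (D a (D j (D k F)))
          * e (D l (G i a)))
      + 3 * (∑ i, ∑ a, ∑ j, ∑ k, e (D i (D j (D k F))) * e (D a (D j (D k F)))
          * e (D l (D l (G i a))))
      + 6 * (∑ i, ∑ j, ∑ k, ∑ a, ∑ b, e (D i (D j (D k F))) * e (D a (D b (D k F)))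
          * e (D l (G i a)) * e (D l (G j b))) := fun l => by
      have : e (D l (D l u)) = ∑ i, ∑ j, ∑ k, ∑ a, ∑ b, ∑ c, e (D l (D l
        (D i (D j (D k F)) * D a (D b (D c F)) * G i a * G j b * G k c))) := by
        simp only [u, map_sum]
      rw [this]
      simp only [deriv_prod5]
      refine (contract_six (fun i j k => e (D i (D j (D k F))))
        (fun i j k => e (D l (D i (D j (D k F))))) (fun i j k => e (D l (D l (D i (D j (D k F))))))
        (fun i j => e (D l (G i j))) (fun i j => e (D l (D l (G i j)))) h.t1 h.t2
        (fun i j k => by rw [h.comm i j]) (fun i j k => by rw [h.comm j k])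
        (fun i j => by rw [h.eDG, h.eDG, h.comm i j]) (fun i j => e (G i j)) h.eG)
    simp only [hl, Finset.sum_add_distrib, ← Finset.mul_sum]
    simp only [h.eDG, h.eDDG]
    have e3 : ∀ l i a, ∑ x, (e (D l (D i (D x F))) * e (D l (D x (D a F))) +
          e (D l (D i (D x F))) * e (D l (D x (D a F)))) = 2 * ∑ c, e (D l (D i (D c F))) * e (D l (D c (D a F))) := by
      intro l i a
      rw [Finset.sum_add_distrib, two_mul]
    simp only [e3]
    simp only [mul_neg, Finset.sum_neg_distrib, neg_mul, neg_neg]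
    have e4 : ∑ l, ∑ i, ∑ j, ∑ k, e (D l (D l (D i (D j (D k F))))) * e (D i (D j (D k F)))
      = ∑ i, ∑ j, ∑ k, (∑ l, e (D l (D l (D i (D j (D k F)))))) * e (D i (D j (D k F))) := by
      simp only [Finset.sum_mul]
      rw [sum4_swap12, sum4_swap23, sum4_swap34]
    rw [e4]
    ring

end Pot
end PotAlg

section PotAlg2
variable {A : Type*} [CommRing A] [Algebra ℝ A] {ι : Type*} [Fintype ι] [DecidableEq ι]

/-- Adds the Euler relation. -/
structure Cone (D : ι → Derivation ℝ A A) (e : A →ₐ[ℝ] ℝ) (F : A) (G : ι → ι → A)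
    (X : ι → A) (N : ℝ) : Prop extends Pot D e F G where
  dX : ∀ i j, D j (X i) = if i = j then 1 else 0
  euler : ∑ i, X i * D i F = algebraMap ℝ A (-N)
  card : (Fintype.card ι : ℝ) = N
  one_le : 1 ≤ N

variable {D : ι → Derivation ℝ A A} {e : A →ₐ[ℝ] ℝ} {F : A} {G : ι → ι → A}
  {X : ι → A} {N : ℝ}

lemma e_pow_mul_d (d : Derivation ℝ A A) (s P : A) (k : ℕ) :
    e (d (s ^ (k + 2) * P)) = (k + 2) * e s ^ (k + 1) * e (d s) * e P
      + e s ^ (k + 2) * e (d P) := by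
  simp only [Derivation.leibniz, Derivation.leibniz_pow, smul_eq_mul, map_add, map_mul, map_pow,
    map_nsmul, nsmul_eq_mul, map_natCast]
  push_cast
  ring

lemma e_pow_mul_dd (d : Derivation ℝ A A) (s P : A) (k : ℕ) :
    e (d (d (s ^ (k + 2) * P))) = (k + 2) * (k + 1) * e s ^ k * e (d s) ^ 2 * e P
      + (k + 2) * e s ^ (k + 1) * e (d (d s)) * e P
      + 2 * (k + 2) * e s ^ (k + 1) * e (d s) * e (d P)
      + e s ^ (k + 2) * e (d (d P)) := by
  simp only [Derivation.leibniz, Derivation.leibniz_pow, smul_eq_mul, map_add, map_mul, map_pow,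
    map_nsmul, nsmul_eq_mul, map_natCast, Derivation.map_natCast]
  push_cast
  simp only [Nat.add_sub_cancel, show k + 2 - 1 = k + 1 from rfl, map_zero]
  ring

namespace Cone

lemma e1 (h : Cone D e F G X N) (j : ι) : e (D j F) = - e (X j) := by
  have := congrArg (fun z => e (D j z)) h.euler
  simp only [map_sum, Derivation.leibniz, smul_eq_mul, map_add, map_mul, h.on, h.dX,
    Derivation.map_algebraMap, map_zero, Finset.sum_add_distrib, mul_ite, mul_one, mul_zero,
    Finset.sum_ite_eq, Finset.sum_ite_eq', Finset.mem_univ, if_true] at this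
  linarith

lemma e2 (h : Cone D e F G X N) (j k : ι) : ∑ i, e (X i) * e (D i (D j (D k F))) = -2 * (if j = k then 1 else 0) := by
  have := congrArg (fun z => e (D j (D k z))) h.euler
  have e0 : ∀ (x y : ι), e (if x = y then (1 : A) else 0) = if x = y then 1 else 0 := by
    intro x y; split_ifs <;> simp
  simp only [map_sum, Derivation.leibniz, smul_eq_mul, map_add, map_mul, h.on, h.dX, deriv_ite,
    Derivation.map_algebraMap, map_zero, Finset.sum_add_distrib, mul_zero, e0, mul_ite, mul_one,
    Finset.sum_const_zero, zero_add, Finset.sum_ite_eq, Finset.sum_ite_eq', Finset.mem_univ, if_true, add_zero] at this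
  have c : ∀ i, e (D i (D j (D k F))) = e (D j (D k (D i F))) := by
    intro i; rw [h.comm i j, h.comm i k]
  simp only [c]
  simp only [eq_comm (a := k) (b := j)] at this
  linarith

lemma e3 (h : Cone D e F G X N) : ∑ i, e (X i) * e (X i) = N := by
  have := congrArg e h.euler
  simp only [map_sum, map_mul, h.e1, AlgHom.commutes, mul_neg, Finset.sum_neg_distrib] at this
  simpa using this

lemma lower (h : Cone D e F G X N) : 12 - 8 / N ≤ ∑ i, ∑ j, ∑ k, e (D i (D j (D k F))) * e (D i (D j (D k F))) :=
  lower_real N (by linarith [h.one_le]) h.card _ (fun i => e (X i)) h.t1 h.t2 h.e2 h.e3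


lemma psi1 (h : Cone D e F G X N) (lam : ι → ℝ) (ell ψ : A) (hl : ∀ i, D i ell = algebraMap ℝ A (lam i))
  (hell : e ell = 1) (hlx : ∑ i, lam i * e (X i) = 1)
  (hψ : ∀ i, ell * D i ψ = - algebraMap ℝ A (lam i) - N⁻¹ • (ell * D i F))
    (l : ι) : e (D l ψ) = - (lam l - e (X l) / N) := by
  have := congrArg e (hψ l)
  simp only [map_mul, hell, map_sub, map_neg, AlgHom.commutes, map_smul, h.e1, smul_eq_mul] at this
  have h2 : (algebraMap ℝ ℝ) (lam l) = lam l := rfl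
  rw [h2] at this
  rw [div_eq_inv_mul]
  linarith

lemma psi2 (h : Cone D e F G X N) (lam : ι → ℝ) (ell ψ : A) (hl : ∀ i, D i ell = algebraMap ℝ A (lam i))
  (hell : e ell = 1) (hlx : ∑ i, lam i * e (X i) = 1)
  (hψ : ∀ i, ell * D i ψ = - algebraMap ℝ A (lam i) - N⁻¹ • (ell * D i F))
    : ∑ l, e (D l (D l ψ)) = ∑ i, lam i * lam i - 1 := by
  have hN : N ≠ 0 := by linarith [h.one_le]
  have key : ∀ l, e (D l (D l ψ)) = lam l * lam l - N⁻¹ := by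
    intro l
    have := congrArg (fun z => e (D l z)) (hψ l)
    simp only [Derivation.leibniz, smul_eq_mul, map_add, map_mul, hell, map_sub, map_neg,
      AlgHom.commutes, map_smul, Derivation.map_smul, h.e1, h.on, if_true, hl, Derivation.map_algebraMap, map_zero,
      h.psi1 lam ell ψ hl hell hlx hψ] at this
    have h2 : (algebraMap ℝ ℝ) (lam l) = lam l := rfl
    rw [h2] at this
    rw [div_eq_inv_mul] at this
    linarith
  simp only [key, Finset.sum_sub_distrib, Finset.sum_const, Finset.card_univ, nsmul_eq_mul, h.card]
  rw [mul_inv_cancel₀ hN]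

lemma psi3 (h : Cone D e F G X N) (lam : ι → ℝ) (ell ψ : A) (hl : ∀ i, D i ell = algebraMap ℝ A (lam i))
  (hell : e ell = 1) (hlx : ∑ i, lam i * e (X i) = 1)
  (hψ : ∀ i, ell * D i ψ = - algebraMap ℝ A (lam i) - N⁻¹ • (ell * D i F))
    : ∑ l, e (D l ψ) ^ 2 = ∑ i, lam i * lam i - 1 / N := by
  have hN : N ≠ 0 := by linarith [h.one_le]
  have key : ∀ l, e (D l ψ) ^ 2 = lam l * lam l - 2 / N * (lam l * e (X l))
      + 1 / N ^ 2 * (e (X l) * e (X l)) := by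
    intro l
    rw [h.psi1 lam ell ψ hl hell hlx hψ]; ring
  simp only [key, Finset.sum_add_distrib, Finset.sum_sub_distrib, ← Finset.mul_sum, hlx, h.e3]
  field_simp
  ring

lemma psi4 (h : Cone D e F G X N) (lam : ι → ℝ) (ell ψ : A) (hl : ∀ i, D i ell = algebraMap ℝ A (lam i))
  (hell : e ell = 1) (hlx : ∑ i, lam i * e (X i) = 1)
  (hψ : ∀ i, ell * D i ψ = - algebraMap ℝ A (lam i) - N⁻¹ • (ell * D i F))
    : ∑ l, e (D l ψ) * lam l = - (∑ i, lam i * lam i - 1 / N) := by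
  have key : ∀ l, e (D l ψ) * lam l = - (lam l * lam l) + 1 / N * (lam l * e (X l)) := by
    intro l
    rw [h.psi1 lam ell ψ hl hell hlx hψ]; ring
  simp only [key, Finset.sum_add_distrib, Finset.sum_neg_distrib, ← Finset.mul_sum, hlx]
  ring

/-- final estimate at a maximum point -/
lemma final_est (h : Cone D e F G X N) (lam : ι → ℝ) (ell ψ : A) (hl : ∀ i, D i ell = algebraMap ℝ A (lam i))
  (hell : e ell = 1) (hlx : ∑ i, lam i * e (X i) = 1)
  (hψ : ∀ i, ell * D i ψ = - algebraMap ℝ A (lam i) - N⁻¹ • (ell * D i F))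
    (u : A) (hu : 0 ≤ e u) (hψ0 : 0 < e ψ) (hp : ∑ i, lam i * lam i ≤ 5)
    (hb : e u * (e u - 4 * N) ≤ 2 * N * ∑ l, e (D l (D l u)))
    (m1 : ∀ l, e (D l (ψ ^ 2 * u)) = 0) (m2 : ∀ l, e (D l (D l (ψ ^ 2 * u))) ≤ 0) :
    e ψ ^ 2 * e u ≤ 4 * N * e ψ ^ 2 + 60 * N + 4 * N * e ψ := by
  have hN := h.one_le
  have f1 : ∀ l, e ψ * e (D l u) = - 2 * e (D l ψ) * e u := by
    intro l
    have := m1 l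
    rw [e_pow_mul_d (k := 0)] at this
    apply mul_left_cancel₀ hψ0.ne'
    push_cast at this
    simp only [zero_add, pow_one] at this
    linarith
  have f2 : ∀ l, e ψ ^ 2 * e (D l (D l u)) ≤ 6 * e u * e (D l ψ) ^ 2 - 2 * e ψ * e u * e (D l (D l ψ)) := by
    intro l
    have := m2 l
    rw [e_pow_mul_dd (k := 0)] at this
    push_cast at this
    simp only [zero_add, pow_one, pow_zero] at this
    have g : 2 * 2 * e ψ * e (D l ψ) * e (D l u) = -8 * e (D l ψ) ^ 2 * e u := by
      linear_combination 4 * e (D l ψ) * f1 l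
    linarith
  have f3 := Finset.sum_le_sum (fun l (_ : l ∈ Finset.univ) => f2 l)
  simp only [Finset.sum_sub_distrib, ← Finset.mul_sum] at f3
  rw [h.psi2 lam ell ψ hl hell hlx hψ, h.psi3 lam ell ψ hl hell hlx hψ] at f3
  set p := ∑ i, lam i * lam i
  have hp0 : 0 ≤ p := Finset.sum_nonneg fun i _ => mul_self_nonneg _
  set L := ∑ l, e (D l (D l u))
  have hNi : 0 ≤ 1 / N := by positivity
  have f4 : e ψ ^ 2 * L ≤ 30 * e u + 2 * e ψ * e u := by
    have a1 : 6 * e u * (p - 1 / N) ≤ 30 * e u := by nlinarith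
    have a2 : - (2 * e ψ * e u * (p - 1)) ≤ 2 * e ψ * e u := by
      have : 0 ≤ e ψ * e u := by positivity
      nlinarith
    linarith
  rcases hu.eq_or_lt with h0 | h0
  · rw [← h0]
    have hN0 : 0 < N := by linarith
    have : 0 ≤ 4 * N * e ψ ^ 2 + 60 * N + 4 * N * e ψ := by positivity
    simpa using this
  · have f5 : e ψ ^ 2 * (e u * (e u - 4 * N)) ≤ 2 * N * (30 * e u + 2 * e ψ * e u) := by
      calc e ψ ^ 2 * (e u * (e u - 4 * N)) ≤ e ψ ^ 2 * (2 * N * L) :=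
            mul_le_mul_of_nonneg_left hb (by positivity)
        _ = 2 * N * (e ψ ^ 2 * L) := by ring
        _ ≤ _ := mul_le_mul_of_nonneg_left f4 (by linarith)
    have : e u * (e ψ ^ 2 * e u) ≤ e u * (4 * N * e ψ ^ 2 + 60 * N + 4 * N * e ψ) := by
      linarith
    exact le_of_mul_le_mul_left this h0

/-- gradient estimate at a maximum point -/
lemma grad_est (h : Cone D e F G X N) (lam : ι → ℝ) (ell ψ : A) (hl : ∀ i, D i ell = algebraMap ℝ A (lam i))
  (hell : e ell = 1) (hlx : ∑ i, lam i * e (X i) = 1)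
  (hψ : ∀ i, ell * D i ψ = - algebraMap ℝ A (lam i) - N⁻¹ • (ell * D i F))
    (k : ℕ) (hk : (k : ℝ) + 2 = 2 * N) (hψ0 : 0 < e ψ) (P : A)
    (hP : P = ∑ i, ∑ j, (lam i * lam j) • G i j) (hp : 0 < e P)
    (m1 : ∀ l, e (D l (ψ ^ (k + 2) * P - (e ψ ^ (k + 2) * e P) • ell ^ 2)) = 0)
    (m2 : ∀ l, e (D l (D l (ψ ^ (k + 2) * P - (e ψ ^ (k + 2) * e P) • ell ^ 2))) ≤ 0) :
    e P ≤ 5 := by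
  have hN := h.one_le
  have hN0 : 0 < N := by linarith
  set s := e ψ with hs
  have heP : e P = ∑ i, lam i * lam i := by
    rw [hP]
    simp [map_sum, h.eG]
  set T : ι → ι → ι → ℝ := fun i j k => e (D i (D j (D k F))) with hT
  have t1 : ∀ i j k, T i j k = T j i k := h.t1
  have t2 : ∀ i j k, T i j k = T i k j := h.t2
  set B : ι → ι → ℝ := fun j k => ∑ i, lam i * T i j k with hB
  have hP1 : ∀ l, e (D l P) = - ∑ j, B l j * lam j := by
    intro l
    rw [hP]
    simp only [map_sum, map_smul, Derivation.map_smul, h.eDG, smul_eq_mul, mul_neg, Finset.sum_neg_distrib, hB,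
      Finset.sum_mul]
    rw [Finset.sum_comm]
    rw [neg_inj]
    refine Finset.sum_congr rfl fun i _ => Finset.sum_congr rfl fun j _ => ?_
    have : e (D l (D j (D i F))) = T j l i := by rw [t1]
    rw [this]; ring
  have hP2 : ∑ l, e (D l (D l P)) = ∑ i, ∑ j, B i j * B i j - 2 * e P := by
    have a1 : ∀ l, e (D l (D l P)) = 2 * ∑ k, B l k * B l k
        - ∑ i, ∑ j, lam i * lam j * e (D l (D l (D i (D j F)))) := by
      intro l
      rw [hP]
      simp only [map_sum, map_smul, Derivation.map_smul, h.eDDG, smul_eq_mul, mul_sub, Finset.sum_sub_distrib]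
      congr 1
      simp only [hB, Finset.sum_mul_sum]
      simp only [Finset.mul_sum]
      rw [sum3_swap23, sum3_swap12]
      refine Finset.sum_congr rfl fun k _ => Finset.sum_congr rfl fun i _ =>
        Finset.sum_congr rfl fun j _ => ?_
      have c1 : e (D l (D i (D k F))) = T i l k := by rw [t1]
      have c2 : e (D l (D k (D j F))) = T j l k := by rw [t1 j, t2 l]
      rw [c1, c2]
      ring
    simp only [a1, Finset.sum_sub_distrib, ← Finset.mul_sum]
    have a2 : ∑ l, ∑ i, ∑ j, lam i * lam j * e (D l (D l (D i (D j F))))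
        = 2 * e P + ∑ i, ∑ j, B i j * B i j := by
      have : ∑ l, ∑ i, ∑ j, lam i * lam j * e (D l (D l (D i (D j F))))
        = ∑ i, ∑ j, lam i * lam j * ∑ l, e (D i (D j (D l (D l F)))) := by
        simp only [Finset.mul_sum]
        rw [sum3_swap12, sum3_swap23]
        refine Finset.sum_congr rfl fun i _ => Finset.sum_congr rfl fun j _ =>
          Finset.sum_congr rfl fun l _ => ?_
        rw [h.comm l i, h.comm l j, h.comm l i, h.comm l j]
      rw [this]
      simp only [h.etr1, mul_add, Finset.sum_add_distrib]
      congr 1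
      · rw [heP, Finset.mul_sum]
        refine Finset.sum_congr rfl fun i _ => ?_
        simp
        ring
      · simp only [hB, Finset.sum_mul_sum]
        simp only [Finset.mul_sum]
        rw [sum22]
        refine Finset.sum_congr rfl fun i _ => Finset.sum_congr rfl fun j _ =>
          Finset.sum_congr rfl fun a _ => Finset.sum_congr rfl fun b _ => ?_
        simp only [hT]; ring
    rw [a2]; ring
  have f1 : ∀ l, ∑ j, B l j * lam j = 2 * N / s * e P * e (D l ψ) - 2 * e P * lam l := by
    intro l
    have := m1 l
    simp only [map_sub, map_smul, Derivation.map_smul, e_pow_mul_d, Derivation.leibniz_pow, hl, hP1, smul_eq_mul,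
      map_mul, map_nsmul, nsmul_eq_mul, hell, ← hs, hk, map_pow, AlgHom.commutes] at this
    have h2 : (algebraMap ℝ ℝ) (lam l) = lam l := rfl
    rw [h2] at this
    have hs0 : s ^ (k + 1) ≠ 0 := by positivity
    have : s ^ (k + 1) * (s * (∑ j, B l j * lam j))
      = s ^ (k + 1) * (2 * N * e P * e (D l ψ) - 2 * s * e P * lam l) := by
      push_cast at this
      rw [pow_succ s (k + 1)] at this
      simp at this
      rw [map_ofNat] at this
      linarith
    have := mul_left_cancel₀ hs0 this
    field_simp
    linarith
  refine grad_real N (e P) (2 * N / s) (e P - 1 / N) hN h.card hp (by positivity) lam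
    (fun i => e (X i)) B heP.symm hlx ?_ rfl ?_ ?_
  · simp only [hB]
    rw [Finset.sum_comm]
    simp only [← Finset.mul_sum, hT, h.etr, h.e1]
    have : ∀ i, lam i * (2 * - e (X i)) = -2 * (lam i * e (X i)) := by intro i; ring
    simp only [this, ← Finset.mul_sum, hlx]; norm_num
  · intro l
    rw [f1, h.psi1 lam ell ψ hl hell hlx hψ]; ring
  · have f2 : ∀ l, (2 * N) * (2 * N - 1) * e (D l ψ) ^ 2 * e P + 2 * N * s * e (D l (D l ψ)) * e P
        - 2 * (2 * N) * s * e (D l ψ) * (∑ j, B l j * lam j) + s ^ 2 * e (D l (D l P))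
        - 2 * s ^ 2 * e P * (lam l * lam l) ≤ 0 := by
      intro l
      have := m2 l
      have hk1 : (k : ℝ) + 1 = 2 * N - 1 := by linarith
      have sq : e (D l (D l (ell ^ 2))) = 2 * (lam l * lam l) := by
        simp only [pow_two, Derivation.leibniz, smul_eq_mul, map_add, hl, map_mul,
          Derivation.map_algebraMap, map_zero, AlgHom.commutes, mul_zero, zero_add]
        have h2 : (algebraMap ℝ ℝ) (lam l) = lam l := rfl
        rw [h2]; ring
      simp only [map_sub, map_smul, Derivation.map_smul, e_pow_mul_dd, sq, hP1, smul_eq_mul, ← hs, hk, hk1] at this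
      have hs0 : 0 < s ^ k := by positivity
      by_contra hc
      push Not at hc
      have := mul_pos hs0 hc
      have e1 : s ^ (k + 1) = s ^ k * s := by ring
      have e2 : s ^ (k + 2) = s ^ k * s ^ 2 := by ring
      rename_i this0
      rw [e1, e2] at this0
      nlinarith
    have f3 := Finset.sum_le_sum (fun l (_ : l ∈ Finset.univ) => f2 l)
    have f4 : ∑ l, e (D l ψ) * (∑ j, B l j * lam j) = 2 * N / s * e P * (e P - 1 / N)
        + 2 * e P * (e P - 1 / N) := by
      have : ∀ l, e (D l ψ) * (∑ j, B l j * lam j) = 2 * N / s * e P * e (D l ψ) ^ 2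
        - 2 * e P * (e (D l ψ) * lam l) := by intro l; rw [f1]; ring
      simp only [this, Finset.sum_sub_distrib, ← Finset.mul_sum,
        h.psi3 lam ell ψ hl hell hlx hψ, h.psi4 lam ell ψ hl hell hlx hψ, heP]
      ring
    have r1 : ∀ l, 2 * (2 * N) * s * e (D l ψ) * (∑ j, B l j * lam j)
      = 2 * (2 * N) * s * (e (D l ψ) * (∑ j, B l j * lam j)) := by intro l; ring
    simp only [r1, Finset.sum_sub_distrib, Finset.sum_add_distrib, ← Finset.mul_sum,
      ← Finset.sum_mul, f4, hP2, h.psi2 lam ell ψ hl hell hlx hψ, h.psi3 lam ell ψ hl hell hlx hψ,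
      ← heP, Finset.sum_const_zero] at f3
    have hs2 : 0 < s ^ 2 := by positivity
    by_contra hc
    push Not at hc
    have := mul_pos hs2 hc
    have hh : 2 * N / s * s = 2 * N := by field_simp
    have : 0 < (2 * N) * (2 * N - 1) * (e P - 1 / N) * e P + 2 * N * s * (e P - 1) * e P
       - 2 * (2 * N) * s * (2 * N / s * e P * (e P - 1 / N)
        + 2 * e P * (e P - 1 / N)) + s ^ 2 * (∑ i, ∑ j, B i j * B i j - 2 * e P)
        - 2 * s ^ 2 * e P * e P := by
      refine this.trans_eq ?_
      field_simp
      ring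
    linarith

end Cone
end PotAlg2

section MatAlg
open Matrix
variable {A : Type*} [CommRing A] [Algebra ℝ A] {ι : Type*} [Fintype ι] [DecidableEq ι]

lemma derivation_finset_prod (d : Derivation ℝ A A) (s : Finset ι) (f : ι → A) :
    d (∏ i ∈ s, f i) = ∑ i ∈ s, d (f i) * ∏ j ∈ s.erase i, f j := by
  induction s using Finset.induction_on with
  | empty => simp
  | insert a s ha ih =>
    rw [Finset.prod_insert ha, Derivation.leibniz, ih, Finset.sum_insert ha, Finset.erase_insert ha,
      smul_eq_mul, smul_eq_mul, mul_comm (∏ i ∈ s, f i), add_comm, Finset.mul_sum]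
    congr 1
    refine Finset.sum_congr rfl fun i hi => ?_
    have hne : a ≠ i := fun h => ha (h ▸ hi)
    rw [Finset.erase_insert_of_ne hne, Finset.prod_insert (by simp [ha])]
    ring

/-- Jacobi's formula for derivations. -/
lemma deriv_det (d : Derivation ℝ A A) (M : Matrix ι ι A) :
    d M.det = ∑ i, ∑ j, M.adjugate i j * d (M j i) := by
  have h1 : ∀ i, ∑ j, M.adjugate i j * d (M j i) = (M.updateCol i (fun j => d (M j i))).det := by
    intro i
    rw [← Matrix.cramer_apply, Matrix.cramer_eq_adjugate_mulVec]
    rfl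
  simp only [h1]
  simp only [Matrix.det_apply, map_sum]
  rw [Finset.sum_comm]
  refine Finset.sum_congr rfl fun σ _ => ?_
  rw [← Finset.smul_sum]
  have : ∀ (z : ℤˣ) (a : A), d (z • a) = z • d a := by
    intro z a
    simp [Units.smul_def]
  rw [this, derivation_finset_prod]
  congr 1
  refine Finset.sum_congr rfl fun i _ => ?_
  rw [← Finset.mul_prod_erase Finset.univ _ (Finset.mem_univ i)]
  congr 1
  · simp
  · refine Finset.prod_congr rfl fun j hj => ?_
    rw [Matrix.updateCol_ne (Finset.ne_of_mem_erase hj)]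

/-- trace equation from the determinant equation -/
lemma trace_eq (d : Derivation ℝ A A) (M : Matrix ι ι A) (E f : A) (hM : M.det = E) (hE : IsUnit E)
    (hdE : d E = E * (d f + d f)) (hsym : ∀ i j, M i j = M j i) :
    ∑ a, ∑ b, M⁻¹ a b * d (M a b) = d f + d f := by
  have h := deriv_det d M
  rw [hM, hdE] at h
  have h2 : M.adjugate = E • M⁻¹ := by
    rw [Matrix.inv_def, hM, smul_smul, Ring.mul_inverse_cancel _ hE, one_smul]
  rw [h2] at h
  apply hE.mul_left_cancel
  rw [h, Finset.mul_sum]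
  refine Finset.sum_congr rfl fun a _ => ?_
  rw [Finset.mul_sum]
  refine Finset.sum_congr rfl fun b _ => ?_
  rw [hsym b a, Matrix.smul_apply, smul_eq_mul, mul_assoc]

lemma quad_change {κ : Type*} [Fintype κ] (B G' : Matrix κ κ A) (x : κ → A) :
    x ⬝ᵥ (B * G' * Bᵀ) *ᵥ x = (Bᵀ *ᵥ x) ⬝ᵥ G' *ᵥ (Bᵀ *ᵥ x) := by
  rw [← Matrix.mulVec_mulVec, ← Matrix.mulVec_mulVec, Matrix.dotProduct_mulVec,
    Matrix.vecMul_eq_sum, Matrix.mulVec_transpose]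
  simp [Matrix.vecMul_eq_sum]

open Kronecker in
lemma six_eq (T : ι → ι → ι → A) (G : Matrix ι ι A) :
    ∑ i, ∑ j, ∑ k, ∑ a, ∑ b, ∑ c, T i j k * T a b c * G i a * G j b * G k c
    = (fun z : (ι × ι) × ι => T z.1.1 z.1.2 z.2) ⬝ᵥ ((G ⊗ₖ G) ⊗ₖ G) *ᵥ
      (fun z : (ι × ι) × ι => T z.1.1 z.1.2 z.2) := by
  simp only [dotProduct, mulVec, Fintype.sum_prod_type, Matrix.kronecker_apply, Finset.mul_sum]
  refine Finset.sum_congr rfl fun i _ => Finset.sum_congr rfl fun j _ =>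
    Finset.sum_congr rfl fun k _ => Finset.sum_congr rfl fun a _ =>
    Finset.sum_congr rfl fun b _ => Finset.sum_congr rfl fun c _ => ?_
  ring

open Kronecker in
lemma six_change (T T' : ι → ι → ι → A) (B G G' : Matrix ι ι A) (hG : G = B * G' * Bᵀ)
    (hT : ∀ i j k, T' i j k = ∑ p, ∑ q, ∑ r, B p i * B q j * B r k * T p q r) :
    ∑ i, ∑ j, ∑ k, ∑ a, ∑ b, ∑ c, T i j k * T a b c * G i a * G j b * G k c
    = ∑ i, ∑ j, ∑ k, ∑ a, ∑ b, ∑ c, T' i j k * T' a b c * G' i a * G' j b * G' k c := by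
  rw [six_eq, six_eq]
  have h1 : (G ⊗ₖ G) ⊗ₖ G = ((B ⊗ₖ B) ⊗ₖ B) * ((G' ⊗ₖ G') ⊗ₖ G') * ((B ⊗ₖ B) ⊗ₖ B)ᵀ := by
    rw [hG]
    simp only [Matrix.mul_kronecker_mul, Matrix.kroneckerMap_transpose]
  have h2 : (fun z : (ι × ι) × ι => T' z.1.1 z.1.2 z.2)
      = ((B ⊗ₖ B) ⊗ₖ B)ᵀ *ᵥ (fun z : (ι × ι) × ι => T z.1.1 z.1.2 z.2) := by
    funext z
    simp only [dotProduct, mulVec, Fintype.sum_prod_type, Matrix.kroneckerMap_apply, hT,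
      Matrix.transpose_apply]
  rw [h1, quad_change, h2]

open MatrixOrder in
lemma exists_frame (H : Matrix ι ι ℝ) (hH : H.PosDef) :
    ∃ B : Matrix ι ι ℝ, Bᵀ * H * B = 1 ∧ IsUnit B.det := by
  obtain ⟨C, hC⟩ := CStarAlgebra.nonneg_iff_eq_star_mul_self.1 hH.posSemidef.nonneg
  have hdet : IsUnit C.det := by
    have := hH.det_pos
    rw [hC, Matrix.det_mul] at this
    exact isUnit_iff_ne_zero.2 (right_ne_zero_of_mul this.ne')
  refine ⟨C⁻¹, ?_, Matrix.isUnit_nonsing_inv_det C hdet⟩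
  rw [hC, Matrix.star_eq_conjTranspose, Matrix.conjTranspose_eq_transpose_of_trivial, ← mul_assoc, ← Matrix.transpose_mul,
    Matrix.mul_nonsing_inv _ hdet, mul_assoc, Matrix.mul_nonsing_inv _ hdet]
  simp

end MatAlg

section Concrete
open Matrix TopologicalSpace ContDiff
variable {m : ℕ} {Ω : Opens (EuclideanSpace ℝ (Fin m))}

/-- standard basis -/
def sb (i : Fin m) : EuclideanSpace ℝ (Fin m) := EuclideanSpace.single i 1

/-- frame given by the columns of a matrix -/
def fr (B : Matrix (Fin m) (Fin m) ℝ) (i : Fin m) : EuclideanSpace ℝ (Fin m) :=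
  ∑ j, B j i • sb j

/-- Hessian matrix in a frame, over the ring of smooth functions. -/
def Hm (f : SF Ω) (b : Fin m → EuclideanSpace ℝ (Fin m)) : Matrix (Fin m) (Fin m) (SF Ω) :=
  Matrix.of fun i j => DD (b i) (DD (b j) f)

/-- The squared norm of the third derivative computed in a frame. -/
def uu (f : SF Ω) (b : Fin m → EuclideanSpace ℝ (Fin m)) : SF Ω :=
  ∑ i, ∑ j, ∑ k, ∑ a, ∑ c, ∑ d,
    DD (b i) (DD (b j) (DD (b k) f)) * DD (b a) (DD (b c) (DD (b d) f))
      * (Hm f b)⁻¹ i a * (Hm f b)⁻¹ j c * (Hm f b)⁻¹ k d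

/-- The squared norm of a covector computed in a frame. -/
def pp (f : SF Ω) (L : EuclideanSpace ℝ (Fin m) →L[ℝ] ℝ) (b : Fin m → EuclideanSpace ℝ (Fin m)) :
    SF Ω :=
  ∑ i, ∑ j, (L (b i) * L (b j)) • (Hm f b)⁻¹ i j

lemma DD_fr (B : Matrix (Fin m) (Fin m) ℝ) (i : Fin m) (f : SF Ω) :
    DD (fr B i) f = ∑ j, B j i • DD (sb j) f := DD_sum _ _ _ _

lemma Hm_sym (f : SF Ω) (b : Fin m → EuclideanSpace ℝ (Fin m)) (i j : Fin m) :
    Hm f b i j = Hm f b j i := DD_comm _ _ _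

/-- constants as functions -/
abbrev cm (B : Matrix (Fin m) (Fin m) ℝ) : Matrix (Fin m) (Fin m) (SF Ω) :=
  B.map (algebraMap ℝ (SF Ω))

lemma det_cm (B : Matrix (Fin m) (Fin m) ℝ) :
    (cm (Ω := Ω) B).det = algebraMap ℝ (SF Ω) B.det := by
  exact ((algebraMap ℝ (SF Ω)).map_det B).symm

lemma Hm_fr (B : Matrix (Fin m) (Fin m) ℝ) (f : SF Ω) :
    Hm f (fr B) = (cm B)ᵀ * Hm f sb * cm B := by
  ext1 i j
  simp only [Hm, Matrix.of_apply, DD_fr, map_sum, Derivation.map_smul, Matrix.mul_apply, Finset.sum_mul,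
    Matrix.transpose_apply, Matrix.map_apply, Finset.smul_sum]
  refine Finset.sum_congr rfl fun p _ => Finset.sum_congr rfl fun q _ => ?_
  rw [Algebra.smul_def, Algebra.smul_def]
  ring

lemma unit_fr (B : Matrix (Fin m) (Fin m) ℝ) (f : SF Ω) (hB : IsUnit B.det)
    (hH : IsUnit (Hm f sb).det) : IsUnit (Hm f (fr B)).det := by
  have hc : IsUnit (cm (Ω := Ω) B).det := by rw [det_cm]; exact hB.map _
  rw [Hm_fr, Matrix.det_mul, Matrix.det_mul, Matrix.det_transpose]
  exact (hc.mul hH).mul hc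

lemma Gm_fr (B : Matrix (Fin m) (Fin m) ℝ) (f : SF Ω) (hB : IsUnit B.det) :
    (Hm f sb)⁻¹ = cm B * (Hm f (fr B))⁻¹ * (cm B)ᵀ := by
  have hc : IsUnit (cm (Ω := Ω) B).det := by rw [det_cm]; exact hB.map _
  have hct : IsUnit ((cm (Ω := Ω) B)ᵀ).det := by rw [Matrix.det_transpose]; exact hc
  rw [Hm_fr, Matrix.mul_inv_rev, Matrix.mul_inv_rev, ← mul_assoc, ← mul_assoc,
    Matrix.mul_nonsing_inv _ hc, one_mul, mul_assoc, Matrix.nonsing_inv_mul _ hct, mul_one]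

lemma uu_fr (B : Matrix (Fin m) (Fin m) ℝ) (f : SF Ω) (hB : IsUnit B.det) :
    uu f (fr B) = uu f sb := by
  symm
  refine six_change _ _ (cm B) _ _ (Gm_fr B f hB) ?_
  intro i j k
  rw [DD_fr B i]
  refine Finset.sum_congr rfl fun p _ => ?_
  rw [DD_fr B j, map_sum, Finset.smul_sum]
  refine Finset.sum_congr rfl fun q _ => ?_
  rw [DD_fr B k]
  simp only [map_sum, Derivation.map_smul, Finset.smul_sum]
  refine Finset.sum_congr rfl fun r _ => ?_
  simp only [Algebra.smul_def, Matrix.map_apply]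
  ring

lemma pp_fr (B : Matrix (Fin m) (Fin m) ℝ) (f : SF Ω) (hB : IsUnit B.det)
    (L : EuclideanSpace ℝ (Fin m) →L[ℝ] ℝ) : pp f L (fr B) = pp f L sb := by
  have h1 : ∀ b : Fin m → EuclideanSpace ℝ (Fin m), pp f L b =
      (fun i => algebraMap ℝ (SF Ω) (L (b i))) ⬝ᵥ (Hm f b)⁻¹ *ᵥ
        (fun i => algebraMap ℝ (SF Ω) (L (b i))) := by
    intro b
    simp only [pp, dotProduct, mulVec, Finset.mul_sum]
    refine Finset.sum_congr rfl fun p _ => Finset.sum_congr rfl fun q _ => ?_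
    rw [Algebra.smul_def, map_mul]; ring
  rw [h1, h1, Gm_fr B f hB, quad_change]
  have h2 : (fun i => algebraMap ℝ (SF Ω) (L (fr B i)))
      = (cm B)ᵀ *ᵥ (fun i => algebraMap ℝ (SF Ω) (L (sb i))) := by
    funext i
    simp [fr, mulVec, dotProduct, map_sum]
  rw [h2]

/-- The data of a canonical potential. -/
structure Can (f : SF Ω) (N : ℝ) : Prop where
  posdef : ∀ x, ((Hm f sb).map (ev x)).PosDef
  ex : ∃ Ex : SF Ω, IsUnit Ex ∧ (Hm f sb).det = Ex ∧ ∀ v, DD v Ex = Ex * (DD v f + DD v f)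
  euler : ∀ x : Ω, ev x (DD (x : EuclideanSpace ℝ (Fin m)) f) = -N
  card : (m : ℝ) = N
  one_le : 1 ≤ N

lemma contDiff_coord (j : Fin m) :
    ContDiff ℝ ∞ (fun x : EuclideanSpace ℝ (Fin m) => x j) := by
  fun_prop

/-- standard coordinate functions -/
def xs (j : Fin m) : SF Ω := SF.mk (fun x => x j) (contDiff_coord j).contDiffOn

/-- linear function -/
def lin (L : EuclideanSpace ℝ (Fin m) →L[ℝ] ℝ) : SF Ω := SF.mk L L.contDiff.contDiffOn

lemma DD_lin (L : EuclideanSpace ℝ (Fin m) →L[ℝ] ℝ) (v : EuclideanSpace ℝ (Fin m)) :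
    DD v (lin (Ω := Ω) L) = algebraMap ℝ (SF Ω) (L v) := by
  apply SF.ext'
  intro x
  rw [lin, ev_DD_mk, AlgHom.commutes, ContinuousLinearMap.fderiv]
  rfl

lemma xs_eq (j : Fin m) : xs (Ω := Ω) j = lin (EuclideanSpace.proj j) := rfl

lemma proj_coord (j : Fin m) (v : EuclideanSpace ℝ (Fin m)) :
    (EuclideanSpace.proj j : EuclideanSpace ℝ (Fin m) →L[ℝ] ℝ) v = v j := rfl

lemma fr_apply (B : Matrix (Fin m) (Fin m) ℝ) (i j : Fin m) : (fr B i) j = B j i := by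
  have : (EuclideanSpace.proj j : EuclideanSpace ℝ (Fin m) →L[ℝ] ℝ) (fr B i) = B j i := by
    rw [fr, map_sum]
    simp [sb, Pi.single_apply]
  exact this

lemma sum_sb (x : EuclideanSpace ℝ (Fin m)) : ∑ j, x j • sb j = x := by
  ext i
  simp [sb, Pi.single_apply]

/-- coordinates in a frame -/
def xf (B : Matrix (Fin m) (Fin m) ℝ) (i : Fin m) : SF Ω := ∑ j, B⁻¹ i j • xs j

lemma sum_xf (B : Matrix (Fin m) (Fin m) ℝ) (hB : IsUnit B.det) (x : Ω) :
    ∑ i, ev x (xf B i) • fr B i = x := by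
  have h1 : ∀ i, ev x (xf B i) = ∑ j, B⁻¹ i j * (x : EuclideanSpace ℝ (Fin m)) j := by
    intro i
    simp [xf, map_sum, xs, ev_mk]
  simp only [h1]
  ext k
  have : (EuclideanSpace.proj k : EuclideanSpace ℝ (Fin m) →L[ℝ] ℝ)
    (∑ i, (∑ j, B⁻¹ i j * (x : EuclideanSpace ℝ (Fin m)) j) • fr B i) =
      (x : EuclideanSpace ℝ (Fin m)) k := by
    rw [map_sum]
    have h2 := congrFun (congrArg (fun M => M *ᵥ (fun j => (x : EuclideanSpace ℝ (Fin m)) j))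
      (Matrix.mul_nonsing_inv B hB)) k
    simp only [← Matrix.mulVec_mulVec, Matrix.one_mulVec] at h2
    simp only [map_smul, proj_coord, fr_apply, smul_eq_mul]
    rw [← h2]
    simp only [mulVec, dotProduct]
    exact Finset.sum_congr rfl fun i _ => mul_comm _ _
  exact this

lemma Hm_inv_mul (f : SF Ω) (b : Fin m → EuclideanSpace ℝ (Fin m)) (hu : IsUnit (Hm f b).det)
    (i j : Fin m) : ∑ a, (Hm f b)⁻¹ i a * DD (b a) (DD (b j) f) = if i = j then 1 else 0 := by
  have := congrFun (congrFun (Matrix.nonsing_inv_mul _ hu) i) j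
  rw [Matrix.mul_apply, Matrix.one_apply] at this
  exact this

lemma Hm_trace (f : SF Ω) (B : Matrix (Fin m) (Fin m) ℝ) (hu : IsUnit (Hm f (fr B)).det)
    (Ex : SF Ω) (hdet : (Hm f sb).det = Ex) (v : EuclideanSpace ℝ (Fin m))
    (hdE : DD v Ex = Ex * (DD v f + DD v f)) :
    ∑ a, ∑ b, (Hm f (fr B))⁻¹ a b * DD v (DD (fr B a) (DD (fr B b) f)) = DD v f + DD v f := by
  have hd : DD v (Hm f (fr B)).det = (Hm f (fr B)).det * (DD v f + DD v f) := by
    rw [Hm_fr, Matrix.det_mul, Matrix.det_mul, Matrix.det_transpose, hdet, det_cm]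
    rw [Derivation.leibniz, Derivation.leibniz, Derivation.map_algebraMap, hdE]
    simp only [smul_eq_mul]
    ring
  exact trace_eq (DD v) (Hm f (fr B)) _ f rfl hu hd (Hm_sym f _)

lemma xf_deriv (B : Matrix (Fin m) (Fin m) ℝ) (hB : IsUnit B.det) (i j : Fin m) :
    DD (fr B j) (xf (Ω := Ω) B i) = if i = j then 1 else 0 := by
  have h1 := congrFun (congrFun (Matrix.nonsing_inv_mul B hB) i) j
  rw [Matrix.mul_apply, Matrix.one_apply] at h1
  rw [show (if i = j then (1 : SF Ω) else 0) = algebraMap ℝ (SF Ω) (if i = j then 1 else 0) by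
      split_ifs <;> simp, ← h1, map_sum, xf, map_sum]
  refine Finset.sum_congr rfl fun k _ => ?_
  rw [Derivation.map_smul, xs_eq, DD_lin, proj_coord, fr_apply, Algebra.smul_def, map_mul]

lemma Hm_on (f : SF Ω) (x : Ω) (B : Matrix (Fin m) (Fin m) ℝ)
    (hBH : Bᵀ * (Hm f sb).map (ev x) * B = 1) (i j : Fin m) :
    ev x (DD (fr B i) (DD (fr B j) f)) = if i = j then 1 else 0 := by
  have := congrArg (fun M => M.map (ev x)) (Hm_fr B f)
  have h2 : (cm (Ω := Ω) B).map (ev x) = B := by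
    ext i j; simp [cm, AlgHom.commutes]
  have h3 : ((cm (Ω := Ω) B)ᵀ).map (ev x) = Bᵀ := by
    ext i j; simp [cm, AlgHom.commutes]
  simp only [Matrix.map_mul, h2, h3, hBH] at this
  have := congrFun (congrFun this i) j
  rw [Matrix.one_apply] at this
  exact this

lemma xf_euler {f : SF Ω} {N : ℝ} (h : ∀ x : Ω, ev x (DD (x : EuclideanSpace ℝ (Fin m)) f) = -N)
    (B : Matrix (Fin m) (Fin m) ℝ)
    (hB : IsUnit B.det) : ∑ i, xf B i * DD (fr B i) f = algebraMap ℝ (SF Ω) (-N) := by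
  apply SF.ext'
  intro y
  rw [AlgHom.commutes, map_sum]
  have h1 := h y
  have h2 : DD (y : EuclideanSpace ℝ (Fin m)) f = ∑ i, ev y (xf B i) • DD (fr B i) f := by
    rw [← DD_sum, sum_xf B hB y]
  rw [h2, map_sum] at h1
  simp only [map_smul, smul_eq_mul] at h1
  simp only [map_mul]
  rw [h1]; rfl

lemma Can.cone {f : SF Ω} {N : ℝ} (h : Can f N) (x : Ω) (B : Matrix (Fin m) (Fin m) ℝ)
    (hB : IsUnit B.det) (hBH : Bᵀ * (Hm f sb).map (ev x) * B = 1) :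
    Cone (fun i => DD (fr B i)) (ev x) f (fun i j => (Hm f (fr B))⁻¹ i j) (xf B) N := by
  obtain ⟨Ex, hEu, hdet, hdE⟩ := h.ex
  have hu : IsUnit (Hm f (fr B)).det := unit_fr B f hB (hdet ▸ hEu)
  exact ⟨⟨fun i j a => DD_comm _ _ _, Hm_inv_mul f _ hu,
    fun k => Hm_trace f B hu Ex hdet _ (hdE _), Hm_on f x B hBH⟩, xf_deriv B hB,
    xf_euler h.euler B hB, by simpa using h.card, h.one_le⟩

end Concrete

section Pointwise
open Matrix TopologicalSpace ContDiff
variable {m : ℕ} {Ω : Opens (EuclideanSpace ℝ (Fin m))}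

lemma Can.exists_cone {f : SF Ω} {N : ℝ} (h : Can f N) (x : Ω) :
    ∃ B : Matrix (Fin m) (Fin m) ℝ, IsUnit B.det ∧
    Cone (fun i => DD (fr B i)) (ev x) f (fun i j => (Hm f (fr B))⁻¹ i j) (xf B) N := by
  obtain ⟨B, h1, h2⟩ := exists_frame _ (h.posdef x)
  exact ⟨B, h2, h.cone x B h2 h1⟩

lemma Can.uu_lower {f : SF Ω} {N : ℝ} (h : Can f N) (x : Ω) :
    12 - 8 / N ≤ ev x (uu f sb) := by
  obtain ⟨B, hB, hc⟩ := h.exists_cone x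
  have h1 := hc.toPot.bochner.1
  have h2 := hc.lower
  rw [← uu_fr B f hB]
  exact h2.trans_eq h1.symm

lemma Can.uu_nonneg {f : SF Ω} {N : ℝ} (h : Can f N) (x : Ω) :
    0 ≤ ev x (uu f sb) := by
  have := h.uu_lower x
  have h1 := h.one_le
  have : 8 / N ≤ 8 := div_le_self (by norm_num) h1
  linarith

lemma sum_lam (B : Matrix (Fin m) (Fin m) ℝ) (hB : IsUnit B.det) (x : Ω)
    (L : EuclideanSpace ℝ (Fin m) →L[ℝ] ℝ) :
    ∑ i, L (fr B i) * ev x (xf B i) = L x := by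
  conv_rhs => rw [← sum_xf B hB x, map_sum]
  refine Finset.sum_congr rfl fun i _ => ?_
  rw [map_smul, smul_eq_mul, mul_comm]

lemma ev_pp {f : SF Ω} {N : ℝ} {x : Ω} {B : Matrix (Fin m) (Fin m) ℝ} (hB : IsUnit B.det)
    (hc : Cone (fun i => DD (fr B i)) (ev x) f (fun i j => (Hm f (fr B))⁻¹ i j) (xf B) N)
    (L : EuclideanSpace ℝ (Fin m) →L[ℝ] ℝ) :
    ev x (pp f L sb) = ∑ i, L (fr B i) * L (fr B i) := by
  rw [← pp_fr B f hB, pp]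
  simp only [map_sum, map_smul]
  have h1 : ∀ i j, ev x ((Hm f (fr B))⁻¹ i j) = if i = j then 1 else 0 := hc.toPot.eG
  simp [h1]

lemma Can.pp_pos {f : SF Ω} {N : ℝ} (h : Can f N) (x : Ω) (L : EuclideanSpace ℝ (Fin m) →L[ℝ] ℝ)
    (hL : L x ≠ 0) : 0 < ev x (pp f L sb) := by
  obtain ⟨B, hB, hc⟩ := h.exists_cone x
  rw [ev_pp hB hc]
  have h0 : 0 ≤ ∑ i, L (fr B i) * L (fr B i) := Finset.sum_nonneg fun i _ => mul_self_nonneg _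
  refine lt_of_le_of_ne h0 fun h1 => hL ?_
  rw [← sum_lam B hB]
  refine Finset.sum_eq_zero fun i _ => ?_
  have := (Finset.sum_eq_zero_iff_of_nonneg (fun i _ => mul_self_nonneg (L (fr B i)))).1 h1.symm i
    (Finset.mem_univ _)
  rw [mul_self_eq_zero.1 this, zero_mul]

/-- `⟨∇F, g⁻¹ ∇F⟩ = N`. -/
lemma Can.grad_norm {f : SF Ω} {N : ℝ} (h : Can f N) (x : Ω) :
    ev x (pp f (fderiv ℝ f.fn x) sb) = N := by
  obtain ⟨B, hB, hc⟩ := h.exists_cone x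
  rw [ev_pp hB hc, ← hc.e3]
  refine Finset.sum_congr rfl fun i _ => ?_
  have := hc.e1 i
  rw [ev_DD] at this
  rw [this]; ring

lemma Can.grad_max {f : SF Ω} {N : ℝ} (h : Can f N) (x : Ω) (L : EuclideanSpace ℝ (Fin m) →L[ℝ] ℝ)
    (hL : L x = 1) (ψ : SF Ω)
    (hψ : ∀ v, lin L * DD v ψ = - algebraMap ℝ (SF Ω) (L v) - N⁻¹ • (lin L * DD v f))
    (k : ℕ) (hk : (k : ℝ) + 2 = 2 * N) (hψ0 : 0 < ev x ψ)
    (hmax : IsLocalMax (ψ ^ (k + 2) * pp f L sb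
      - (ev x ψ ^ (k + 2) * ev x (pp f L sb)) • (lin L) ^ 2).fn (x : EuclideanSpace ℝ (Fin m))) :
    ev x (pp f L sb) ≤ 5 := by
  obtain ⟨B, hB, hc⟩ := h.exists_cone x
  refine hc.grad_est (fun i => L (fr B i)) (lin L) ψ (fun i => DD_lin L _) hL ?_
    (fun i => hψ _) k hk hψ0 _ (pp_fr B f hB L).symm ?_ ?_ ?_
  · rw [sum_lam B hB, hL]
  · exact h.pp_pos x L (by rw [hL]; exact one_ne_zero)
  · exact fun l => SF.local_max_first _ x hmax _
  · exact fun l => SF.local_max_second _ x hmax _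

lemma Can.final_max {f : SF Ω} {N : ℝ} (h : Can f N) (x : Ω) (L : EuclideanSpace ℝ (Fin m) →L[ℝ] ℝ)
    (hL : L x = 1) (ψ : SF Ω)
    (hψ : ∀ v, lin L * DD v ψ = - algebraMap ℝ (SF Ω) (L v) - N⁻¹ • (lin L * DD v f))
    (hp : ev x (pp f L sb) ≤ 5) (hψ0 : 0 < ev x ψ)
    (hmax : IsLocalMax (ψ ^ 2 * uu f sb).fn (x : EuclideanSpace ℝ (Fin m))) :
    ev x ψ ^ 2 * ev x (uu f sb) ≤ 4 * N * ev x ψ ^ 2 + 60 * N + 4 * N * ev x ψ := by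
  obtain ⟨B, hB, hc⟩ := h.exists_cone x
  have hb := hc.toPot.bochner.2
  rw [hc.card] at hb
  change ev x (uu f (fr B)) * (ev x (uu f (fr B)) - 4 * N) ≤
    2 * N * ∑ l, ev x (DD (fr B l) (DD (fr B l) (uu f (fr B)))) at hb
  rw [uu_fr B f hB] at hb
  refine hc.final_est (fun i => L (fr B i)) (lin L) ψ (fun i => DD_lin L _) hL ?_
    (fun i => hψ _) _ (h.uu_nonneg x) hψ0 ?_ hb ?_ ?_
  · rw [sum_lam B hB, hL]
  · exact (ev_pp hB hc L).symm.trans_le hp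
  · exact fun l => SF.local_max_first _ x hmax _
  · exact fun l => SF.local_max_second _ x hmax _

end Pointwise

section Build
open Matrix TopologicalSpace ContDiff
variable {m : ℕ} {Ω : Opens (EuclideanSpace ℝ (Fin m))}

lemma ev_second (F : Euc m → ℝ) (hF : ContDiffOn ℝ ∞ F Ω) (x : Ω) (a b : Euc m) :
    ev x (DD a (DD b (SF.mk F hF))) = iteratedFDeriv ℝ 2 F x ![a, b] := by
  have h1 : (SF.mk F hF).fn =ᶠ[nhds (x : Euc m)] F := SF.fn_eventuallyEq (fun _ => rfl) x
  rw [ev_DD_DD, iteratedFDeriv_two_apply, h1.fderiv.fderiv_eq]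
  rfl

lemma ev_third (F : Euc m → ℝ) (hF : ContDiffOn ℝ ∞ F Ω) (x : Ω) (a b c : Euc m) :
    ev x (DD a (DD b (DD c (SF.mk F hF)))) = iteratedFDeriv ℝ 3 F x ![a, b, c] := by
  rw [ev_DD_of_eq a _ (g := fun y => iteratedFDeriv ℝ 2 F y ![b, c])
    (fun y => ev_second F hF y b c), iteratedFDeriv_succ_apply_left]
  have hd : DifferentiableAt ℝ (iteratedFDeriv ℝ 2 F) x :=
    (hF.contDiffAt (Ω.2.mem_nhds x.2)).differentiableAt_iteratedFDeriv (by
      exact WithTop.coe_lt_coe.2 (WithTop.coe_lt_top _))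
  rw [fderiv_continuousMultilinear_apply_const_apply hd]
  rfl

lemma ev_Hm (F : Euc m → ℝ) (hF : ContDiffOn ℝ ∞ F Ω) (x : Ω) :
    (Hm (SF.mk F hF) sb).map (ev x) = hessMatrix F x := by
  ext i j
  exact ev_second F hF x _ _

lemma ev_inv (f : SF Ω) (hu : IsUnit (Hm f sb).det) (x : Ω) (i j : Fin m) :
    ev x ((Hm f sb)⁻¹ i j) = ((Hm f sb).map (ev x))⁻¹ i j := by
  have h1 : ((Hm f sb)⁻¹).map (ev x) * (Hm f sb).map (ev x) = 1 := by
    rw [← Matrix.map_mul, Matrix.nonsing_inv_mul _ hu]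
    exact Matrix.map_one _ (map_zero _) (map_one _)
  rw [Matrix.inv_eq_left_inv h1]
  rfl

lemma euler_of_log (F : Euc m → ℝ) (hF : ContDiffOn ℝ ∞ F Ω) (N : ℝ)
    (hlog : ∀ x ∈ Ω, ∀ t : ℝ, F (Real.exp t • x) = F x - N * t) (x : Ω) :
    fderiv ℝ F x x = -N := by
  have hd : HasFDerivAt F (fderiv ℝ F x) ((Real.exp 0 • (x : Euc m))) := by
    simpa using ((hF.contDiffAt (Ω.2.mem_nhds x.2)).differentiableAt (by simp)).hasFDerivAt
  have h1 : HasDerivAt (fun t : ℝ => Real.exp t • (x : Euc m)) (x : Euc m) 0 := by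
    simpa using (Real.hasDerivAt_exp 0).smul_const (x : Euc m)
  have h2 := hd.comp_hasDerivAt 0 h1
  have h3 : HasDerivAt (fun t : ℝ => F x - N * t) (-N) 0 := by
    simpa using ((hasDerivAt_id (0 : ℝ)).const_mul N).const_sub (F x)
  have h4 : (F ∘ fun t : ℝ => Real.exp t • (x : Euc m)) = fun t : ℝ => F x - N * t :=
    funext fun t => hlog x x.2 t
  rw [h4] at h2
  exact h2.unique h3

lemma can_mk (F : Euc m → ℝ) (hF : ContDiffOn ℝ ∞ F Ω) (N : ℝ) (hm : (m : ℝ) = N) (hN : 1 ≤ N)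
    (hpos : ∀ x ∈ Ω, (hessMatrix F x).PosDef)
    (hdet : ∀ x ∈ Ω, (hessMatrix F x).det = Real.exp (2 * F x))
    (hlog : ∀ x ∈ Ω, ∀ t : ℝ, F (Real.exp t • x) = F x - N * t) :
    Can (SF.mk F hF) N := by
  refine ⟨fun x => ?_, ?_, fun x => ?_, hm, hN⟩
  · rw [ev_Hm]; exact hpos x x.2
  · have hE : ContDiffOn ℝ ∞ (fun x => Real.exp (2 * F x)) Ω :=
      (contDiffOn_const.mul hF).exp
    have hE' : ContDiffOn ℝ ∞ (fun x => Real.exp (-(2 * F x))) Ω :=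
      (contDiffOn_const.mul hF).neg.exp
    refine ⟨SF.mk _ hE, ?_, ?_, ?_⟩
    · refine IsUnit.of_mul_eq_one (SF.mk _ hE') ?_
      apply SF.ext'
      intro x
      rw [map_mul, ev_mk, ev_mk, map_one, ← Real.exp_add, add_neg_cancel, Real.exp_zero]
    · apply SF.ext'
      intro x
      have : ev x (Hm (SF.mk F hF) sb).det = ((Hm (SF.mk F hF) sb).map (ev x)).det :=
        (ev x).map_det _
      rw [this, ev_Hm, hdet x x.2, ev_mk]
    · intro v
      apply SF.ext'
      intro x
      rw [map_mul, map_add, ev_DD_mk, ev_DD_mk, ev_mk]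
      have hd : DifferentiableAt ℝ F x :=
        (hF.contDiffAt (Ω.2.mem_nhds x.2)).differentiableAt (by simp)
      have := ((hd.hasFDerivAt.const_mul 2).exp).fderiv
      rw [this]
      simp
      ring
  · rw [ev_DD_mk]; exact euler_of_log F hF N hlog x

/-- scaling of derivatives of homogeneous functions -/
lemma DD_scale (g : SF Ω) (s a c : ℝ) (hs : 0 < s) (hΩ : ∀ x : Ω, s • (x : Euc m) ∈ Ω)
    (hg : ∀ x : Ω, ev ⟨_, hΩ x⟩ g = a * ev x g + c) (v : Euc m) (x : Ω) :
    ev ⟨_, hΩ x⟩ (DD v g) = s⁻¹ * a * ev x (DD v g) := by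
  have h1 : (fun y : Euc m => g.fn (s • y)) =ᶠ[nhds (x : Euc m)] fun y => a * g.fn y + c := by
    filter_upwards [Ω.2.mem_nhds x.2] with y hy
    have := hg ⟨y, hy⟩
    rw [← SF.fn_apply, ← SF.fn_apply] at this
    exact this
  have h2 : HasFDerivAt (fun y : Euc m => g.fn (s • y))
      ((fderiv ℝ g.fn (s • (x : Euc m))).comp (s • ContinuousLinearMap.id ℝ (Euc m))) x :=
    HasFDerivAt.comp (x : Euc m) (g.differentiableAt ⟨_, hΩ x⟩).hasFDerivAt
      ((hasFDerivAt_id (x : Euc m)).const_smul s)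
  have h3 : HasFDerivAt (fun y : Euc m => a * g.fn y + c) (a • fderiv ℝ g.fn x) x :=
    ((g.differentiableAt x).hasFDerivAt.const_mul a).add_const c
  have h4 := congrArg (fun l => l v) ((h3.congr_of_eventuallyEq h1).unique h2)
  simp only [_root_.smul_apply, ContinuousLinearMap.comp_apply, map_smul,
    ContinuousLinearMap.id_apply, smul_eq_mul] at h4
  rw [ev_DD, ev_DD, mul_assoc, h4, ← mul_assoc, inv_mul_cancel₀ hs.ne', one_mul]

lemma hom_facts (f : SF Ω) (s c : ℝ) (hs : 0 < s) (hΩ : ∀ x : Ω, s • (x : Euc m) ∈ Ω)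
    (hu : IsUnit (Hm f sb).det)
    (hf : ∀ x : Ω, ev ⟨_, hΩ x⟩ f = ev x f + c) (x : Ω) :
    ev ⟨_, hΩ x⟩ (uu f sb) = ev x (uu f sb) ∧
    ∀ L, ev ⟨_, hΩ x⟩ (pp f L sb) = s ^ 2 * ev x (pp f L sb) := by
  have d1 : ∀ (a : Euc m) (x : Ω), ev ⟨_, hΩ x⟩ (DD a f) = s⁻¹ * ev x (DD a f) := by
    intro a x
    rw [DD_scale f s 1 c hs hΩ (fun x => by rw [hf, one_mul]), mul_one]
  have d2 : ∀ (a b : Euc m) (x : Ω), ev ⟨_, hΩ x⟩ (DD a (DD b f)) =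
      s⁻¹ * s⁻¹ * ev x (DD a (DD b f)) := fun a b x =>
    DD_scale (DD b f) s s⁻¹ 0 hs hΩ (fun x => by rw [d1, add_zero]) a x
  have d3 : ∀ (a b d : Euc m) (x : Ω), ev ⟨_, hΩ x⟩ (DD a (DD b (DD d f))) =
      s⁻¹ * (s⁻¹ * s⁻¹) * ev x (DD a (DD b (DD d f))) := fun a b d x =>
    DD_scale (DD b (DD d f)) s (s⁻¹ * s⁻¹) 0 hs hΩ (fun x => by rw [d2, add_zero]) a x
  have hG : ∀ i j, ev ⟨_, hΩ x⟩ ((Hm f sb)⁻¹ i j) = s ^ 2 * ev x ((Hm f sb)⁻¹ i j) := by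
    intro i j
    have hH : (Hm f sb).map (ev ⟨_, hΩ x⟩) = (s⁻¹ * s⁻¹) • (Hm f sb).map (ev x) := by
      ext i j
      exact d2 _ _ x
    have h1 : ((Hm f sb)⁻¹).map (ev x) * (Hm f sb).map (ev x) = 1 := by
      rw [← Matrix.map_mul, Matrix.nonsing_inv_mul _ hu]
      exact Matrix.map_one _ (map_zero _) (map_one _)
    have h2 : (s ^ 2 • ((Hm f sb)⁻¹).map (ev x)) * (Hm f sb).map (ev ⟨_, hΩ x⟩) = 1 := by
      rw [hH, Matrix.smul_mul, Matrix.mul_smul, h1, smul_smul]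
      have : s ^ 2 * (s⁻¹ * s⁻¹) = 1 := by field_simp
      rw [this, one_smul]
    rw [ev_inv f hu, Matrix.inv_eq_left_inv h2]
    rfl
  constructor
  · simp only [uu, map_sum, map_mul, d3, hG]
    refine Finset.sum_congr rfl fun i _ => Finset.sum_congr rfl fun j _ =>
      Finset.sum_congr rfl fun k _ => Finset.sum_congr rfl fun a _ =>
      Finset.sum_congr rfl fun b _ => Finset.sum_congr rfl fun d _ => ?_
    field_simp
  · intro L
    simp only [pp, map_sum, map_smul, hG, Finset.mul_sum, smul_eq_mul]
    refine Finset.sum_congr rfl fun i _ => Finset.sum_congr rfl fun j _ => ?_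
    ring

end Build

section Global
open Matrix TopologicalSpace ContDiff Filter
variable {m : ℕ} {Ω : Opens (EuclideanSpace ℝ (Fin m))}

/-- All the hypotheses used in the maximum principle arguments. -/
structure Setup (Ω : Opens (Euc m)) (F : Euc m → ℝ) (hF : ContDiffOn ℝ ∞ F Ω) (N : ℝ) : Prop where
  can : Can (SF.mk F hF) N
  log : ∀ x ∈ Ω, ∀ s : ℝ, 0 < s → F (s • x) = F x - N * Real.log s
  conv : Convex ℝ (Ω : Set (Euc m))
  sc : ∀ x ∈ Ω, ∀ s : ℝ, 0 < s → s • x ∈ Ω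
  bl : BlowsUpOnBoundary (Ω : Set (Euc m)) F

lemma second_pos {f : SF Ω} {x : Ω} (hp : ((Hm f sb).map (ev x)).PosDef) (v : Euc m) (hv : v ≠ 0) :
    0 < ev x (DD v (DD v f)) := by
  have h1 : DD v (DD v f) = ∑ i, v i • ∑ j, v j • DD (sb i) (DD (sb j) f) := by
    have h2 : ∀ g : SF Ω, DD v g = ∑ i, v i • DD (sb i) g := by
      intro g
      rw [← DD_sum, sum_sb]
    rw [h2 (DD v f)]
    refine Finset.sum_congr rfl fun i _ => ?_
    rw [h2 f, map_sum]
    congr 1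
    refine Finset.sum_congr rfl fun j _ => ?_
    rw [Derivation.map_smul]
  have hv' : (fun i => v i) ≠ 0 := by
    intro h
    apply hv
    ext i
    exact congrFun h i
  have h3 := hp.dotProduct_mulVec_pos hv'
  rw [h1]
  refine h3.trans_eq ?_
  simp only [map_sum, map_smul, dotProduct, mulVec, smul_eq_mul, Matrix.map_apply]
  refine Finset.sum_congr rfl fun i _ => ?_
  congr 1
  refine Finset.sum_congr rfl fun j _ => ?_
  rw [mul_comm]; rfl

variable {F : Euc m → ℝ} {hF : ContDiffOn ℝ ∞ F Ω} {N : ℝ}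

/-- Strict convexity. -/
lemma Setup.grad_ineq (h : Setup Ω F hF N) (y x : Ω) (hxy : x ≠ y) :
    F y + fderiv ℝ F y ((x : Euc m) - y) < F x := by
  set v : Euc m := (x : Euc m) - y with hv
  have hv0 : v ≠ 0 := fun h0 => hxy (Subtype.ext (sub_eq_zero.1 h0))
  have hmem : ∀ t ∈ Set.Icc (0 : ℝ) 1, (y : Euc m) + t • v ∈ Ω := by
    intro t ht
    have := h.conv.add_smul_sub_mem y.2 x.2 ht
    exact this
  set f := SF.mk F hF with hf
  have hd1 : ∀ t (ht : t ∈ Set.Icc (0 : ℝ) 1), HasDerivAt (fun s : ℝ => f.fn ((y : Euc m) + s • v))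
      ((DD v f).fn ((y : Euc m) + t • v)) t := by
    intro t ht
    have := f.hasDerivAt_line y v t (hmem t ht)
    rw [← SF.fn_apply] at this
    exact this
  have hd2 : ∀ t (ht : t ∈ Set.Icc (0 : ℝ) 1),
      HasDerivAt (fun s : ℝ => (DD v f).fn ((y : Euc m) + s • v))
      ((DD v (DD v f)).fn ((y : Euc m) + t • v)) t := by
    intro t ht
    have := (DD v f).hasDerivAt_line y v t (hmem t ht)
    rw [← SF.fn_apply] at this
    exact this
  obtain ⟨c, hc, hc1⟩ := exists_hasDerivAt_eq_slope (fun s : ℝ => f.fn ((y : Euc m) + s • v))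
    (fun s => (DD v f).fn ((y : Euc m) + s • v)) zero_lt_one
    (fun t ht => (hd1 t ht).continuousAt.continuousWithinAt)
    (fun t ht => hd1 t ⟨ht.1.le, ht.2.le⟩)
  obtain ⟨c', hc', hc2⟩ := exists_hasDerivAt_eq_slope
    (fun s : ℝ => (DD v f).fn ((y : Euc m) + s • v))
    (fun s => (DD v (DD v f)).fn ((y : Euc m) + s • v)) hc.1
    (fun t ht => (hd2 t ⟨ht.1, ht.2.trans hc.2.le⟩).continuousAt.continuousWithinAt)
    (fun t ht => hd2 t ⟨ht.1.le, ht.2.le.trans hc.2.le⟩)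
  have hpos : 0 < (DD v (DD v f)).fn ((y : Euc m) + c' • v) := by
    have hm := hmem c' ⟨hc'.1.le, hc'.2.le.trans hc.2.le⟩
    have := second_pos (h.can.posdef ⟨_, hm⟩) v hv0
    rw [← SF.fn_apply] at this
    exact this
  have e0 : f.fn ((y : Euc m) + (0 : ℝ) • v) = F y := by
    rw [zero_smul, add_zero, SF.fn_apply]; rfl
  have e1 : f.fn ((y : Euc m) + (1 : ℝ) • v) = F x := by
    rw [one_smul, hv, add_sub_cancel, SF.fn_apply]; rfl
  have e2 : (DD v f).fn ((y : Euc m) + (0 : ℝ) • v) = fderiv ℝ F y v := by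
    rw [zero_smul, add_zero, SF.fn_apply, ev_DD_mk]
  rw [hc2] at hpos
  simp only [e0, e1, e2, sub_zero, div_one] at hc1 hpos
  have h3 := (div_pos_iff_of_pos_right hc.1).1 hpos
  linarith

lemma Setup.grad_le (h : Setup Ω F hF N) (y x : Ω) :
    F y + fderiv ℝ F y ((x : Euc m) - y) ≤ F x := by
  by_cases hxy : x = y
  · rw [hxy]; simp
  · exact (h.grad_ineq y x hxy).le

lemma Setup.euler (h : Setup Ω F hF N) (y : Ω) : fderiv ℝ F y y = -N := by
  have := h.can.euler y
  rwa [ev_DD_mk] at this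

lemma Setup.Npos (h : Setup Ω F hF N) : 0 < N := zero_lt_one.trans_le h.can.one_le

/-- the normalised gradient -/
def LL (F : Euc m → ℝ) (N : ℝ) (y : Euc m) : Euc m →L[ℝ] ℝ := (-N⁻¹) • fderiv ℝ F y

lemma LL_apply (F : Euc m → ℝ) (N : ℝ) (y x : Euc m) : LL F N y x = -N⁻¹ * fderiv ℝ F y x := rfl

lemma Setup.fd (h : Setup Ω F hF N) (y x : Euc m) : fderiv ℝ F y x = - N * LL F N y x := by
  rw [LL_apply]
  have := h.Npos
  field_simp

lemma Setup.LL_self (h : Setup Ω F hF N) (y : Ω) : LL F N y y = 1 := by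
  rw [LL_apply, h.euler]
  have := h.Npos
  field_simp

lemma Setup.key (h : Setup Ω F hF N) (y x : Ω) (s : ℝ) (hs : 0 < s) :
    F y + N + N * Real.log s - F x ≤ N * s * LL F N y x := by
  have h1 := h.grad_le y ⟨s • (x : Euc m), h.sc x x.2 s hs⟩
  simp only [map_sub, map_smul, smul_eq_mul, h.fd, h.LL_self, h.log x x.2 s hs] at h1
  linarith

lemma Setup.LL_pos (h : Setup Ω F hF N) (y x : Ω) : 0 < LL F N y x := by
  by_contra hc
  push Not at hc
  have hN := h.Npos
  have h1 := h.key y x (Real.exp ((F x - F y) / N)) (Real.exp_pos _)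
  rw [Real.log_exp, mul_div_cancel₀ _ hN.ne'] at h1
  have h2 : N * Real.exp ((F x - F y) / N) * LL F N y x ≤ 0 :=
    mul_nonpos_of_nonneg_of_nonpos (by positivity) hc
  linarith

/-- the degree zero exhaustion function -/
def phi (F : Euc m → ℝ) (N : ℝ) (y : Euc m) (x : Euc m) : ℝ :=
  Real.log (LL F N y x) + N⁻¹ * F x - N⁻¹ * F y

lemma Setup.phi_nonneg (h : Setup Ω F hF N) (y x : Ω) : 0 ≤ phi F N y x := by
  have hN := h.Npos
  have hL := h.LL_pos y x
  have h1 := h.key y x (LL F N y x)⁻¹ (inv_pos.2 hL)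
  rw [mul_assoc, inv_mul_cancel₀ hL.ne', Real.log_inv] at h1
  have h2 : 0 ≤ N * phi F N y x := by
    rw [phi]
    have : N * (Real.log (LL F N y x) + N⁻¹ * F x - N⁻¹ * F y) =
      N * Real.log (LL F N y x) + F x - F y := by field_simp
    rw [this]; linarith
  exact nonneg_of_mul_nonneg_right h2 hN

lemma Setup.phi_self (h : Setup Ω F hF N) (y : Ω) : phi F N y y = 0 := by
  rw [phi, h.LL_self, Real.log_one]; ring

lemma Setup.phi_scale (h : Setup Ω F hF N) (y x : Ω) (s : ℝ) (hs : 0 < s) :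
    phi F N y (s • (x : Euc m)) = phi F N y x := by
  have hN := h.Npos
  have hL := h.LL_pos y x
  rw [phi, phi, h.log x x.2 s hs, map_smul, smul_eq_mul, Real.log_mul hs.ne' hL.ne']
  field_simp
  ring

lemma Setup.LL_nonneg_closure (h : Setup Ω F hF N) (y : Ω) (x : Euc m)
    (hx : x ∈ closure (Ω : Set (Euc m))) : 0 ≤ LL F N y x := by
  have hc : IsClosed {x : Euc m | 0 ≤ LL F N y x} :=
    isClosed_le continuous_const (LL F N y).continuous
  exact closure_minimal (fun z hz => (h.LL_pos y ⟨z, hz⟩).le) hc hx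

lemma Setup.add_mem (h : Setup Ω F hF N) (y : Ω) (x : Euc m)
    (hx : x ∈ closure (Ω : Set (Euc m))) : (y : Euc m) + x ∈ Ω := by
  have hy : (y : Euc m) ∈ interior (Ω : Set (Euc m)) := by
    rw [Ω.isOpen.interior_eq]; exact y.2
  have h1 := h.conv.combo_interior_closure_mem_interior hy hx (a := 1 / 2) (b := 1 / 2)
    (by norm_num) (by norm_num) (by norm_num)
  have h2 := h.sc _ (interior_subset h1) 2 (by norm_num)
  rw [← smul_add, smul_smul] at h2
  simpa using h2

lemma Setup.LL_pos_closure (h : Setup Ω F hF N) (y : Ω) (x : Euc m)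
    (hx : x ∈ closure (Ω : Set (Euc m))) (hx0 : x ≠ 0) : 0 < LL F N y x := by
  refine lt_of_le_of_ne (h.LL_nonneg_closure y x hx) fun h0 => ?_
  have hN := h.Npos
  set z : Ω := ⟨(y : Euc m) + x, h.add_mem y x hx⟩ with hz
  have hzy : z ≠ y := by
    intro hh
    apply hx0
    have := congrArg Subtype.val hh
    simpa [hz] using this
  have h1 := h.grad_ineq y z hzy
  have h2 := h.grad_le z y
  have e1 : (z : Euc m) - y = x := by simp [hz]
  have e2 : (y : Euc m) - z = - x := by simp [hz]
  rw [e1, h.fd, ← h0] at h1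
  rw [e2, map_neg, h.fd] at h2
  have h3 := mul_nonneg hN.le (h.LL_nonneg_closure z x hx)
  linarith

lemma Setup.LL_bound (h : Setup Ω F hF N) (y : Ω) :
    ∃ c > 0, ∀ x ∈ closure (Ω : Set (Euc m)), c * ‖x‖ ≤ LL F N y x := by
  have hcone : ∀ x ∈ closure (Ω : Set (Euc m)), ∀ s : ℝ, 0 < s →
      s • x ∈ closure (Ω : Set (Euc m)) := by
    intro x hx s hs
    exact map_mem_closure (continuous_const_smul s) hx (fun z hz => h.sc z hz s hs)
  set S : Set (Euc m) := closure (Ω : Set (Euc m)) ∩ Metric.sphere 0 1 with hS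
  have hSc : IsCompact S := (isCompact_sphere (0 : Euc m) 1).inter_left isClosed_closure
  have hnorm : ∀ x ∈ closure (Ω : Set (Euc m)), x ≠ 0 → ‖x‖⁻¹ • x ∈ S := by
    intro x hx hx0
    refine ⟨hcone x hx _ (by positivity), ?_⟩
    simp [norm_smul, hx0]
  rcases S.eq_empty_or_nonempty with he | hne
  · refine ⟨1, one_pos, fun x hx => ?_⟩
    by_cases hx0 : x = 0
    · simp [hx0]
    · exact absurd (hnorm x hx hx0) (by rw [he]; exact Set.notMem_empty _)
  · obtain ⟨x0, hx0S, hmin⟩ := hSc.exists_isMinOn hne (LL F N y).continuous.continuousOn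
    have hx00 : x0 ≠ 0 := by
      intro h0
      have := hx0S.2
      simp [h0] at this
    refine ⟨LL F N y x0, h.LL_pos_closure y x0 hx0S.1 hx00, fun x hx => ?_⟩
    by_cases hx0 : x = 0
    · simp [hx0]
    · have h1 := hmin (hnorm x hx hx0)
      simp only [Set.mem_ofPred_eq, map_smul, smul_eq_mul] at h1
      have hp : 0 < ‖x‖ := norm_pos_iff.2 hx0
      rw [inv_mul_eq_div, le_div_iff₀ hp] at h1
      exact h1

/-- The truncated slice. -/
def slice (Ω : Opens (Euc m)) (F : Euc m → ℝ) (N : ℝ) (y : Euc m) (K : ℝ) : Set (Euc m) :=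
  {x | x ∈ Ω ∧ LL F N y x = 1 ∧ phi F N y x ≤ K}

lemma Setup.slice_compact (h : Setup Ω F hF N) (y : Ω) (K : ℝ) :
    IsCompact (slice Ω F N y K) := by
  have hN := h.Npos
  apply Metric.isCompact_of_isClosed_isBounded
  · apply IsSeqClosed.isClosed
    intro u z hu hz
    have hzc : z ∈ closure (Ω : Set (Euc m)) :=
      mem_closure_of_tendsto hz (Eventually.of_forall fun k => (hu k).1)
    have hLz : LL F N y z = 1 := by
      have h1 := ((LL F N y).continuous.tendsto z).comp hz
      have h2 : (⇑(LL F N ↑y) ∘ u) = fun _ => 1 := funext fun k => (hu k).2.1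
      rw [h2] at h1
      exact tendsto_nhds_unique h1 tendsto_const_nhds |>.symm ▸ rfl
    have hb : ∀ x ∈ Ω, LL F N y x = 1 → (phi F N y x ≤ K ↔ F x ≤ N * K + F y) := by
      intro x _ hx1
      rw [phi, hx1, Real.log_one, zero_add, ← mul_sub, inv_mul_le_iff₀ hN, sub_le_iff_le_add]
    by_cases hzΩ : z ∈ Ω
    · refine ⟨hzΩ, hLz, (hb z hzΩ hLz).2 ?_⟩
      have hc : ContinuousAt F z := (hF.continuousOn).continuousAt (Ω.2.mem_nhds hzΩ)
      refine le_of_tendsto (hc.tendsto.comp hz) (Eventually.of_forall fun k => ?_)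
      exact (hb _ (hu k).1 (hu k).2.1).1 (hu k).2.2
    · exfalso
      have hfr : z ∈ frontier (Ω : Set (Euc m)) := by
        rw [Ω.isOpen.frontier_eq]; exact ⟨hzc, hzΩ⟩
      have ht := h.bl z hfr u (fun k => (hu k).1) hz
      obtain ⟨k, hk⟩ := (ht.eventually_gt_atTop (N * K + F y)).exists
      exact absurd ((hb _ (hu k).1 (hu k).2.1).1 (hu k).2.2) (not_le.2 hk)
  · obtain ⟨c, hc, hcb⟩ := h.LL_bound y
    refine (Metric.isBounded_closedBall (x := (0 : Euc m)) (r := c⁻¹)).subset ?_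
    intro x hx
    have := hcb x (subset_closure hx.1)
    rw [hx.2.1] at this
    rw [mem_closedBall_zero_iff, ← one_div, le_div_iff₀ hc]
    linarith

lemma Setup.phi_smooth (h : Setup Ω F hF N) (y : Ω) (K : ℝ) :
    ContDiffOn ℝ ∞ (fun x => K - phi F N y x) Ω := by
  refine contDiffOn_const.sub ?_
  refine ContDiffOn.sub (ContDiffOn.add ?_ (contDiffOn_const.mul hF)) contDiffOn_const
  exact (LL F N y).contDiff.contDiffOn.log (fun x hx => (h.LL_pos y ⟨x, hx⟩).ne')

/-- the cut-off function -/
def psi (h : Setup Ω F hF N) (y : Ω) (K : ℝ) : SF Ω := SF.mk _ (h.phi_smooth y K)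

lemma ev_psi (h : Setup Ω F hF N) (y : Ω) (K : ℝ) (x : Ω) :
    ev x (psi h y K) = K - phi F N y x := rfl

lemma psi_deriv (h : Setup Ω F hF N) (y : Ω) (K : ℝ) (v : Euc m) :
    lin (LL F N y) * DD v (psi h y K) = - algebraMap ℝ (SF Ω) (LL F N y v)
      - N⁻¹ • (lin (LL F N y) * DD v (SF.mk F hF)) := by
  apply SF.ext'
  intro x
  have hL := h.LL_pos y x
  have hd : HasFDerivAt F (fderiv ℝ F x) x :=
    ((hF.contDiffAt (Ω.2.mem_nhds x.2)).differentiableAt (by simp)).hasFDerivAt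
  have h1 : HasFDerivAt (fun z => K - phi F N y z)
      (-((LL F N y x)⁻¹ • LL F N y + N⁻¹ • fderiv ℝ F x)) (x : Euc m) := by
    have hl := ((LL F N y).hasFDerivAt (x := (x : Euc m))).log hL.ne'
    exact ((hl.add (hd.const_mul N⁻¹)).sub_const _).const_sub K
  rw [map_mul, map_sub, map_neg, map_smul, map_mul, AlgHom.commutes, psi, ev_DD_mk, ev_DD_mk,
    h1.fderiv]
  have e1 : ev x (lin (LL F N y)) = LL F N y x := rfl
  rw [e1]
  simp only [_root_.neg_apply, _root_.add_apply, _root_.smul_apply, smul_eq_mul,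
    Algebra.algebraMap_self, RingHom.id_apply]
  field_simp
  ring

end Global

section Maximum
open Matrix TopologicalSpace ContDiff Filter
variable {m : ℕ} {Ω : Opens (EuclideanSpace ℝ (Fin m))}
variable {F : Euc m → ℝ} {hF : ContDiffOn ℝ ∞ F Ω} {N : ℝ}

/-- The maximum principle on the projectivised cone. -/
lemma Setup.max_principle (h : Setup Ω F hF N) (y : Ω) (K : ℝ) (g : SF Ω) (d k : ℕ) (b : ℝ)
    (hb : 0 ≤ b)
    (hg : ∀ (x : Ω) (s : ℝ) (hs : 0 < s),
      ev ⟨s • (x : Euc m), h.sc x x.2 s hs⟩ g = s ^ d * ev x g)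
    (hmax : ∀ x : Ω, LL F N y x = 1 → 0 < ev x (psi h y K) →
      IsLocalMax (psi h y K ^ (k + 1) * g
        - (ev x (psi h y K) ^ (k + 1) * ev x g) • (lin (LL F N y)) ^ d).fn (x : Euc m) →
      ev x (psi h y K) ^ (k + 1) * ev x g ≤ b)
    (x : Ω) (hx : LL F N y x = 1) (hxK : 0 ≤ ev x (psi h y K)) :
    ev x (psi h y K) ^ (k + 1) * ev x g ≤ b := by
  set ψ := psi h y K with hψ
  have hxS : (x : Euc m) ∈ slice Ω F N y K := by
    refine ⟨x.2, hx, ?_⟩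
    rw [hψ, ev_psi] at hxK
    linarith
  have hcont : ContinuousOn (ψ ^ (k + 1) * g).fn (slice Ω F N y K) :=
    (ψ ^ (k + 1) * g).contDiffOn.continuousOn.mono fun z hz => hz.1
  obtain ⟨x0, hx0, hm⟩ := (h.slice_compact y K).exists_isMaxOn ⟨_, hxS⟩ hcont
  set z0 : Ω := ⟨x0, hx0.1⟩ with hz0
  have hval : ∀ z : Ω, (ψ ^ (k + 1) * g).fn z = ev z ψ ^ (k + 1) * ev z g := by
    intro z
    rw [SF.fn_apply, map_mul, map_pow]
  have hle : ∀ z : Ω, (z : Euc m) ∈ slice Ω F N y K →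
      ev z ψ ^ (k + 1) * ev z g ≤ ev z0 ψ ^ (k + 1) * ev z0 g := by
    intro z hz
    rw [← hval, ← hval]
    exact hm hz
  refine (hle x hxS).trans ?_
  have hψ0 : 0 ≤ ev z0 ψ := by
    rw [hψ, ev_psi]
    have := hx0.2.2
    simp only [hz0]
    linarith
  rcases hψ0.eq_or_lt with h0 | h0
  · rw [← h0]
    simpa using hb
  refine hmax z0 hx0.2.1 h0 ?_
  have hψc : ContinuousAt ψ.fn (z0 : Euc m) := (ψ.differentiableAt z0).continuousAt
  have hev : ∀ᶠ z in nhds (z0 : Euc m), 0 < ψ.fn z := by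
    apply hψc.eventually_const_lt
    rw [SF.fn_apply]; exact h0
  filter_upwards [hev, Ω.isOpen.mem_nhds z0.2] with z hz hzΩ
  set w : Ω := ⟨z, hzΩ⟩ with hw
  have hL := h.LL_pos y w
  have hLi : 0 < (LL F N y w)⁻¹ := inv_pos.2 hL
  set w' : Ω := ⟨(LL F N y w)⁻¹ • (w : Euc m), h.sc w w.2 _ hLi⟩ with hw'
  have hψw : 0 < ev w ψ := by rw [← SF.fn_apply]; exact hz
  have e1 : ev w' ψ = ev w ψ := by
    rw [hψ, ev_psi, ev_psi]
    have := h.phi_scale y w _ hLi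
    simp only [hw']
    rw [this]
  have e2 : ev w' g = ((LL F N y w)⁻¹) ^ d * ev w g := hg w _ hLi
  have h1 : ev w' ψ ^ (k + 1) * ev w' g ≤ ev z0 ψ ^ (k + 1) * ev z0 g := by
    refine hle w' ⟨w'.2, ?_, ?_⟩
    · rw [hw', map_smul, smul_eq_mul, inv_mul_cancel₀ hL.ne']
    · rw [hψ, ev_psi] at hψw
      have := h.phi_scale y w _ hLi
      simp only [hw']
      rw [this]
      linarith
  rw [e1, e2] at h1
  have h2 : ev w ψ ^ (k + 1) * ev w g ≤ ev z0 ψ ^ (k + 1) * ev z0 g * LL F N y w ^ d := by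
    have h3 := mul_le_mul_of_nonneg_right h1 (pow_nonneg hL.le d)
    refine le_trans (le_of_eq ?_) h3
    rw [inv_pow]
    field_simp
  have hz' : z = (w : Euc m) := rfl
  have el : ∀ q : Ω, ev q (lin (LL F N y)) = LL F N y q := fun q => rfl
  rw [hz', SF.fn_apply, SF.fn_apply, map_sub, map_sub, map_smul, map_smul, map_mul, map_mul,
    map_pow, map_pow, map_pow, map_pow, el, el, smul_eq_mul, smul_eq_mul]
  have h4 : LL F N y z0 = 1 := hx0.2.1
  rw [h4, one_pow, mul_one, sub_self]
  linarith

lemma Setup.scale (h : Setup Ω F hF N) (x : Ω) (s : ℝ) (hs : 0 < s) :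
    ev ⟨s • (x : Euc m), h.sc x x.2 s hs⟩ (uu (SF.mk F hF) sb) = ev x (uu (SF.mk F hF) sb) ∧
    ∀ L, ev ⟨s • (x : Euc m), h.sc x x.2 s hs⟩ (pp (SF.mk F hF) L sb)
      = s ^ 2 * ev x (pp (SF.mk F hF) L sb) := by
  obtain ⟨Ex, hEu, hdet, hdE⟩ := h.can.ex
  exact hom_facts (SF.mk F hF) s (-(N * Real.log s)) hs (fun x => h.sc x x.2 s hs)
    (hdet ▸ hEu) (fun x => by rw [ev_mk, ev_mk, h.log x x.2 s hs]; ring) x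

lemma Setup.psi_le (h : Setup Ω F hF N) (y : Ω) (K : ℝ) (x : Ω) : ev x (psi h y K) ≤ K := by
  rw [ev_psi]
  have := h.phi_nonneg y x
  linarith

/-- The gradient estimate. -/
lemma Setup.pp_le (h : Setup Ω F hF N) (y x : Ω) (hx : LL F N y x = 1) (k : ℕ)
    (hk : (k : ℝ) + 2 = 2 * N) :
    ev x (pp (SF.mk F hF) (LL F N y) sb) ≤ 5 := by
  set P := pp (SF.mk F hF) (LL F N y) sb with hP
  have hKK : ∀ K : ℝ, phi F N y x ≤ K → 0 < K →
      (K - phi F N y x) ^ (k + 1 + 1) * ev x P ≤ K ^ (k + 1 + 1) * 5 := by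
    intro K hK hK0
    rw [← ev_psi h]
    refine h.max_principle y K P 2 (k + 1) _ (by positivity)
      (fun x s hs => (h.scale x s hs).2 _) ?_ x hx ?_
    · intro z hz hψ hmax
      have h1 := h.can.grad_max z (LL F N y) hz (psi h y K) (psi_deriv h y K) k hk hψ hmax
      have h2 := h.psi_le y K z
      exact mul_le_mul (pow_le_pow_left₀ hψ.le h2 _) h1
        (h.can.pp_pos z (LL F N y) (by rw [hz]; exact one_ne_zero)).le (by positivity)
    · rw [ev_psi]; linarith
  have ht : Tendsto (fun K : ℝ => (1 - phi F N y x / K) ^ (k + 1 + 1) * ev x P) atTop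
      (nhds ((1 - 0) ^ (k + 1 + 1) * ev x P)) :=
    ((tendsto_const_nhds.sub (tendsto_const_nhds.div_atTop tendsto_id)).pow _).mul_const _
  rw [sub_zero, one_pow, one_mul] at ht
  refine le_of_tendsto ht ?_
  filter_upwards [eventually_ge_atTop (phi F N y x), eventually_gt_atTop 0] with K hK hK0
  have h1 := hKK K hK hK0
  have h2 : 1 - phi F N y x / K = (K - phi F N y x) / K := by field_simp
  rw [h2, div_pow, div_mul_eq_mul_div, div_le_iff₀ (by positivity)]
  linarith

lemma Setup.uu_le (h : Setup Ω F hF N) (y : Ω) (k : ℕ) (hk : (k : ℝ) + 2 = 2 * N) :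
    ev y (uu (SF.mk F hF) sb) ≤ 4 * N := by
  have hN := h.Npos
  set U := uu (SF.mk F hF) sb with hU
  have hKK : ∀ K : ℝ, 0 < K → K ^ 2 * ev y U ≤ 4 * N * K ^ 2 + 60 * N + 4 * N * K := by
    intro K hK0
    have hy : ev y (psi h y K) = K := by rw [ev_psi, h.phi_self, sub_zero]
    have := h.max_principle y K U 0 1 (4 * N * K ^ 2 + 60 * N + 4 * N * K) (by positivity)
      (fun x s hs => by rw [(h.scale x s hs).1, pow_zero, one_mul]) ?_ y (h.LL_self y)
      (by rw [hy]; exact hK0.le)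
    · rw [hy] at this
      exact this
    · intro z hz hψ hmax
      have hmax' : IsLocalMax (psi h y K ^ 2 * U).fn (z : Euc m) := by
        filter_upwards [hmax, Ω.isOpen.mem_nhds z.2] with w hw hwΩ
        have hw' : w = ((⟨w, hwΩ⟩ : Ω) : Euc m) := rfl
        rw [hw', SF.fn_apply, SF.fn_apply, pow_zero, map_sub, map_sub, map_smul, map_smul,
          map_one, map_one] at hw
        rw [hw', SF.fn_apply, SF.fn_apply]
        linarith
      have h1 := h.can.final_max z (LL F N y) hz (psi h y K) (psi_deriv h y K)
        (h.pp_le y z hz k hk) hψ hmax'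
      have h2 := h.psi_le y K z
      refine h1.trans ?_
      gcongr
  have ht : Tendsto (fun K : ℝ => 4 * N + 60 * N / K ^ 2 + 4 * N / K) atTop
      (nhds (4 * N + 0 + 0)) :=
    (tendsto_const_nhds.add (tendsto_const_nhds.div_atTop
      (tendsto_pow_atTop two_ne_zero))).add (tendsto_const_nhds.div_atTop tendsto_id)
  rw [add_zero, add_zero] at ht
  refine ge_of_tendsto ht ?_
  filter_upwards [eventually_gt_atTop 0] with K hK0
  have h1 := hKK K hK0
  have h2 : 4 * N + 60 * N / K ^ 2 + 4 * N / K
      = (4 * N * K ^ 2 + 60 * N + 4 * N * K) / K ^ 2 := by field_simp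
  rw [h2, le_div_iff₀ (by positivity)]
  linarith

end Maximum

/-- Bounds on the scalar curvature of the canonical Hessian metric of a proper open
convex cone, equivalently on the `g`-norm of the third derivative of the canonical
potential. -/
theorem scalar_curvature_bounds_canonical_metric
    (n : ℕ) (Ω : Set (Euc (n + 1))) (hΩ : IsOpenProperConvexCone Ω)
    (F : Euc (n + 1) → ℝ) (hF : IsCanonicalPotential n Ω F) :
    ∀ x ∈ Ω,
      let ginv := (hessMatrix F x)⁻¹
      let T : Fin (n + 1) → Fin (n + 1) → Fin (n + 1) → ℝ := fun i j k =>
        iteratedFDeriv ℝ 3 F x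
          ![EuclideanSpace.single i 1, EuclideanSpace.single j 1, EuclideanSpace.single k 1]
      let normT2 : ℝ := ∑ i, ∑ j, ∑ k, ∑ a, ∑ b, ∑ c,
        T i j k * T a b c * ginv i a * ginv j b * ginv k c
      let gradVec : Fin (n + 1) → ℝ := fun i => fderiv ℝ F x (EuclideanSpace.single i 1)
      let Q : ℝ := ∑ i, ∑ a, gradVec i * gradVec a * ginv i a
      let R : ℝ := (1 / 4) * (normT2 - 4 * Q)
      (-((n : ℝ) * ((n : ℝ) - 1)) / ((n : ℝ) + 1) ≤ R ∧ R ≤ 0) ∧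
      (4 * (3 * (n : ℝ) + 1) / ((n : ℝ) + 1) ≤ normT2 ∧ normT2 ≤ 4 * ((n : ℝ) + 1)) := by
  intro x hx ginv T normT2 gradVec Q R
  obtain ⟨_, hopen, hconv, hcone, _⟩ := hΩ
  obtain ⟨hsm, hpos, hdet, hlog, hbl⟩ := hF
  set Om : TopologicalSpace.Opens (Euc (n + 1)) := ⟨Ω, hopen⟩ with hOm
  have hN1 : (1 : ℝ) ≤ (n : ℝ) + 1 := by
    have : (0 : ℝ) ≤ n := Nat.cast_nonneg n
    linarith
  have hsm' : ContDiffOn ℝ ((⊤ : ℕ∞) : WithTop ℕ∞) F Om := hsm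
  have hcan : Can (SF.mk F hsm') ((n : ℝ) + 1) :=
    can_mk F hsm' _ (by push_cast; ring) hN1 hpos hdet hlog
  have hs : Setup Om F hsm' ((n : ℝ) + 1) := by
    refine ⟨hcan, ?_, hconv, ?_, hbl⟩
    · intro z hz s hs
      have := hlog z hz (Real.log s)
      rwa [Real.exp_log hs] at this
    · intro z hz s hs
      have := hcone z hz (Real.log s)
      rwa [Real.exp_log hs] at this
  obtain ⟨Ex, hEu, hEd, -⟩ := hcan.ex
  have hu : IsUnit (Hm (SF.mk F hsm') sb).det := hEd ▸ hEu
  set y : Om := ⟨x, hx⟩ with hy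
  have hG : ∀ i j, ev y ((Hm (SF.mk F hsm') sb)⁻¹ i j) = ginv i j := by
    intro i j
    rw [ev_inv _ hu, ev_Hm]
  have hT : ∀ i j k, ev y (DD (sb i) (DD (sb j) (DD (sb k) (SF.mk F hsm')))) = T i j k := by
    intro i j k
    exact ev_third F hsm' y _ _ _
  have hnorm : ev y (uu (SF.mk F hsm') sb) = normT2 := by
    simp only [uu, map_sum, map_mul, hG, hT, normT2]
  have hQ : Q = (n : ℝ) + 1 := by
    rw [← hcan.grad_norm y]
    have h1 : fderiv ℝ (SF.mk F hsm').fn y = fderiv ℝ F x :=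
      (SF.fn_eventuallyEq (fun _ => rfl) y).fderiv_eq
    rw [h1]
    simp only [pp, map_sum, map_smul, hG, Q, smul_eq_mul]
    rfl
  have hlow : 4 * (3 * (n : ℝ) + 1) / ((n : ℝ) + 1) ≤ normT2 := by
    have h1 := hcan.uu_lower y
    rw [hnorm] at h1
    refine le_trans (le_of_eq ?_) h1
    field_simp
    ring
  have hup : normT2 ≤ 4 * ((n : ℝ) + 1) := by
    have h1 := hs.uu_le y (2 * n) (by push_cast; ring)
    rwa [hnorm] at h1
  refine ⟨⟨?_, ?_⟩, hlow, hup⟩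
  · have h1 : -((n : ℝ) * ((n : ℝ) - 1)) / ((n : ℝ) + 1)
        = (1 / 4) * (4 * (3 * (n : ℝ) + 1) / ((n : ℝ) + 1) - 4 * ((n : ℝ) + 1)) := by
      field_simp
      ring
    simp only [R]
    rw [h1, hQ]
    linarith
  · simp only [R]
    rw [hQ]
    linarith
end
end

section
/- Let Ω ⊆ ℝ^{n+1} be a nonempty proper open convex cone, let F be a canonical potential of Ω, let B > 0 and C > 0, and let ψ : (log(B/C), ∞) → ℝ be a differentiable function with ψ′(t) = (C·e^{−t} − B·e^{−2t})^{1/(n+1)} for all t > log(B/C). Then on the open set Ω_{B,C} = {x ∈ Ω : F(x) > log(B/C)} the function G = ψ ∘ F has positive definite Hessian D²G(x) at every point and satisfies det D²G(x) = B identically; in particular D²G is a Riemannian Monge–Ampère (Hessian) metric on Ω_{B,C}, the region between the hyperbolic affine sphere {F = log(B/C)} and the boundary of Ω. -/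
open scoped RealInnerProductSpace

noncomputable section

open Matrix in
lemma rank_one_perturb {n : ℕ} (H : Matrix (Fin (n+1)) (Fin (n+1)) ℝ) (hH : H.PosDef)
    (x g : Fin (n+1) → ℝ) (hx : H *ᵥ x = -g) (hg : g ⬝ᵥ x = -((n:ℝ)+1)) (a b : ℝ) (ha : 0 < a)
    (hab : 0 < a + (n+1) * b) :
    (a • H + b • vecMulVec g g).PosDef ∧
    (a • H + b • vecMulVec g g).det = a ^ (n+1) * (1 + (n+1) * (b / a)) * H.det := by
  have hN : (0:ℝ) < n + 1 := by positivity
  constructor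
  · refine PosDef.of_dotProduct_mulVec_pos ?_ ?_
    · refine IsHermitian.add ?_ ?_
      · have := hH.1
        rw [IsHermitian, conjTranspose_eq_transpose_of_trivial] at *
        rw [transpose_smul, this]
      · rw [IsHermitian, conjTranspose_eq_transpose_of_trivial, transpose_smul,
          transpose_vecMulVec]
    · intro v hv
      have hT : Hᵀ = H := by
        have := hH.1
        rwa [IsHermitian, conjTranspose_eq_transpose_of_trivial] at this
      have hxv : x ⬝ᵥ (H *ᵥ v) = -(g ⬝ᵥ v) := by
        rw [dotProduct_mulVec, ← mulVec_transpose, hT, hx, neg_dotProduct]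
      have hvx : v ⬝ᵥ (H *ᵥ x) = -(g ⬝ᵥ v) := by
        rw [hx, dotProduct_neg, dotProduct_comm]
      have hxx : x ⬝ᵥ (H *ᵥ x) = n + 1 := by
        rw [hx, dotProduct_neg, dotProduct_comm, hg, neg_neg]
      set s := g ⬝ᵥ v with hs
      have hvv : 0 < v ⬝ᵥ (H *ᵥ v) := by simpa using hH.dotProduct_mulVec_pos hv
      have hw : 0 ≤ v ⬝ᵥ (H *ᵥ v) - s^2/(n+1) := by
        have := hH.posSemidef.dotProduct_mulVec_nonneg (v + (s/(n+1)) • x)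
        simp only [star_trivial, mulVec_add, mulVec_smul, add_dotProduct, dotProduct_add,
          smul_dotProduct, dotProduct_smul, hxv, hvx, hxx, smul_eq_mul] at this
        refine this.trans (le_of_eq ?_)
        field_simp
        ring
      have key : star v ⬝ᵥ ((a • H + b • vecMulVec g g) *ᵥ v) = a * (v ⬝ᵥ (H *ᵥ v)) + b * s^2 := by
        simp only [star_trivial, add_mulVec, smul_mulVec, dotProduct_add, dotProduct_smul,
          vecMulVec_mulVec, smul_eq_mul,
          op_smul_eq_smul]
        rw [dotProduct_comm v g, ← hs]; ring
      rw [key]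
      set q := v ⬝ᵥ (H *ᵥ v)
      rcases le_or_gt 0 b with hb | hb
      · positivity
      · have h1 : s^2 ≤ (n+1) * q := by
          have : s^2/(n+1) ≤ q := by linarith
          rw [div_le_iff₀ hN] at this; linarith
        nlinarith [mul_pos hab hvv]
  · have : a • H + b • vecMulVec g g
        = H * (a • (1 + replicateCol Unit (-(b/a) • x) * replicateRow Unit g)) := by
      rw [← vecMulVec_eq, Matrix.mul_smul, mul_add, mul_one, mul_vecMulVec, mulVec_smul, hx, smul_add,
        neg_smul, smul_neg, neg_neg, smul_vecMulVec, smul_smul, mul_div_cancel₀ _ ha.ne']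
    rw [this, det_mul, det_smul, det_one_add_replicateCol_mul_replicateRow, dotProduct_smul, hg,
      Fintype.card_fin, smul_eq_mul]
    ring

lemma euler_cone {n : ℕ} {Ω : Set (Euc (n+1))} (hΩ : IsOpen Ω) {F : Euc (n+1) → ℝ}
    (hF : ContDiffOn ℝ (⊤ : ℕ∞) F Ω)
    (hom : ∀ x ∈ Ω, ∀ t : ℝ, F (Real.exp t • x) = F x - (n + 1) * t) (x : Euc (n+1)) (hx : x ∈ Ω) :
    fderiv ℝ F x x = -((n:ℝ)+1) := by
  have hd : HasFDerivAt F (fderiv ℝ F x) x :=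
    ((hF.contDiffAt (hΩ.mem_nhds hx)).differentiableAt (by simp)).hasFDerivAt
  have h1 : HasDerivAt (fun t : ℝ => Real.exp t • x) x 0 := by
    simpa using (Real.hasDerivAt_exp 0).smul_const x
  have h2 : HasDerivAt (fun t : ℝ => F (Real.exp t • x)) (fderiv ℝ F x x) 0 := by
    refine HasFDerivAt.comp_hasDerivAt (0:ℝ) (l := F) ?_ h1
    simpa using hd
  have h3 : HasDerivAt (fun t : ℝ => F (Real.exp t • x)) (-((n:ℝ)+1)) 0 := by
    have : (fun t : ℝ => F (Real.exp t • x)) = fun t => F x - (n+1) * t := funext (hom x hx)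
    rw [this]
    simpa using ((hasDerivAt_id (0:ℝ)).const_mul ((n:ℝ)+1)).const_sub (F x)
  exact h2.unique h3

lemma euc_sum {m : ℕ} (x : Euc m) : x = ∑ i, x i • EuclideanSpace.single i (1:ℝ) := by
  ext j
  simp [Finset.sum_apply, Pi.single_apply]

open Matrix

/-- Riemannian Monge–Ampère metrics between a hyperbolic affine sphere (a level set of
the canonical potential) and the boundary of the cone: `G = ψ ∘ F` has positive definite
Hessian with constant Hessian determinant `B` on `{F > log (B/C)}`. -/
theorem riemannian_monge_ampere_metric_on_cone
    (n : ℕ) (Ω : Set (Euc (n + 1))) (hΩ : IsOpenProperConvexCone Ω)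
    (F : Euc (n + 1) → ℝ) (hF : IsCanonicalPotential n Ω F)
    (B C : ℝ) (hB : 0 < B) (hC : 0 < C)
    (ψ : ℝ → ℝ)
    (hψ : ∀ t : ℝ, Real.log (B / C) < t →
      HasDerivAt ψ ((C * Real.exp (-t) - B * Real.exp (-2 * t)) ^ ((1 : ℝ) / (n + 1))) t) :
    ∀ x ∈ Ω, Real.log (B / C) < F x →
      (hessMatrix (ψ ∘ F) x).PosDef ∧ (hessMatrix (ψ ∘ F) x).det = B := by
  intro x hx hlt
  obtain ⟨-, hO, -, -, -⟩ := hΩ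
  obtain ⟨hsm, hpd, hdet, hom, -⟩ := hF
  have hN : (0:ℝ) < n + 1 := by positivity
  have hcd : ∀ y ∈ Ω, HasFDerivAt F (fderiv ℝ F y) y := fun y hy =>
    ((hsm.contDiffAt (hO.mem_nhds hy)).differentiableAt (by simp)).hasFDerivAt
  have hcd2 : HasFDerivAt (fderiv ℝ F) (fderiv ℝ (fderiv ℝ F) x) x := by
    have h2 : ContDiffAt ℝ 2 F x := (hsm.contDiffAt (hO.mem_nhds hx)).of_le (by norm_cast)
    exact ((h2.fderiv_right (m := 1) (by norm_num)).differentiableAt (by simp)).hasFDerivAt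
  have hE : ∀ v, fderiv ℝ (fderiv ℝ F) x v x = -(fderiv ℝ F x v) := by
    intro v
    have h1 := hcd2.clm_apply (hasFDerivAt_id x)
    have h2 : HasFDerivAt (fun y => fderiv ℝ F y (id y)) (0 : Euc (n+1) →L[ℝ] ℝ) x := by
      refine (hasFDerivAt_const (-((n:ℝ)+1)) x).congr_of_eventuallyEq ?_
      filter_upwards [hO.mem_nhds hx] with y hy
      exact euler_cone hO hsm hom y hy
    have h3 := congrArg (fun L : Euc (n+1) →L[ℝ] ℝ => L v) (h1.unique h2)
    simp at h3
    linarith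
  set u : ℝ → ℝ := fun t => C * Real.exp (-t) - B * Real.exp (-2 * t) with hu
  have hut : 0 < u (F x) := by
    have h1 : B / C < Real.exp (F x) := (Real.log_lt_iff_lt_exp (by positivity)).1 hlt
    rw [div_lt_iff₀ hC] at h1
    have h2 : u (F x) = Real.exp (-2 * F x) * (Real.exp (F x) * C - B) := by
      simp only [hu]
      rw [mul_sub, ← mul_assoc, ← Real.exp_add]
      ring_nf
    rw [h2]
    exact mul_pos (Real.exp_pos _) (by linarith)
  have hdu : HasDerivAt u (-C * Real.exp (-F x) + 2 * B * Real.exp (-2 * F x)) (F x) := by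
    have h1 := ((hasDerivAt_id (F x)).neg.exp).const_mul C
    have h2 := (((hasDerivAt_id (F x)).const_mul (-2)).exp).const_mul B
    refine (h1.sub h2).congr_deriv ?_
    simp; ring
  set du := -C * Real.exp (-F x) + 2 * B * Real.exp (-2 * F x) with hdu_eq
  set p : ℝ := 1 / ((n:ℝ)+1) with hp
  set a := u (F x) ^ p with ha
  set b := du * p * u (F x) ^ (p - 1) with hb
  have hφ : HasDerivAt (fun t => u t ^ p) b (F x) := hdu.rpow_const (Or.inl hut.ne')
  have hapos : 0 < a := Real.rpow_pos_of_pos hut _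
  have haN : a ^ (n+1) = u (F x) := by
    rw [ha, ← Real.rpow_natCast, ← Real.rpow_mul hut.le, hp]
    push_cast
    rw [one_div_mul_cancel hN.ne', Real.rpow_one]
  have hba : (n+1) * (b / a) = du / u (F x) := by
    rw [hb, Real.rpow_sub_one hut.ne', ← ha, hp]
    field_simp
  have hsum : u (F x) + du = B * Real.exp (-2 * F x) := by
    simp only [hu, hdu_eq]; ring
  have hone : 1 + (n+1) * (b / a) = B * Real.exp (-2 * F x) / u (F x) := by
    rw [hba, ← hsum]; field_simp
  have hab : 0 < a + (n+1) * b := by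
    have : a + (n+1) * b = a * (1 + (n+1) * (b/a)) := by field_simp
    rw [this, hone]; positivity
  have hG : HasFDerivAt (fderiv ℝ (ψ ∘ F))
      (a • fderiv ℝ (fderiv ℝ F) x + (b • fderiv ℝ F x).smulRight (fderiv ℝ F x)) x := by
    have h1 : HasFDerivAt (fun y => (u (F y) ^ p) • fderiv ℝ F y)
        (a • fderiv ℝ (fderiv ℝ F) x + (b • fderiv ℝ F x).smulRight (fderiv ℝ F x)) x :=
      (hφ.comp_hasFDerivAt x (hcd x hx)).smul hcd2
    refine h1.congr_of_eventuallyEq ?_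
    filter_upwards [hO.mem_nhds hx, (hcd x hx).continuousAt.eventually (lt_mem_nhds hlt)] with y hy hy2
    exact ((hψ (F y) hy2).comp_hasFDerivAt y (hcd y hy)).fderiv
  set g : Fin (n+1) → ℝ := fun i => fderiv ℝ F x (EuclideanSpace.single i 1) with hg
  have hM : hessMatrix (ψ ∘ F) x = a • hessMatrix F x + b • vecMulVec g g := by
    ext i j
    simp [hessMatrix, iteratedFDeriv_two_apply, hG.fderiv, vecMulVec_apply, hg]
    ring
  have hHx : hessMatrix F x *ᵥ (fun i => x i) = -g := by
    ext i
    have h1 := hE (EuclideanSpace.single i 1)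
    conv_lhs at h1 => arg 2; rw [euc_sum x]
    simp only [map_sum, map_smul, smul_eq_mul] at h1
    simp only [mulVec, dotProduct, hessMatrix, iteratedFDeriv_two_apply, Pi.neg_apply, hg]
    rw [← h1]
    exact Finset.sum_congr rfl fun j _ => by simp [mul_comm]
  have hgx : g ⬝ᵥ (fun i => x i) = -((n:ℝ)+1) := by
    have h1 := euler_cone hO hsm hom x hx
    conv_lhs at h1 => arg 2; rw [euc_sum x]
    simp only [map_sum, map_smul, smul_eq_mul] at h1
    rw [← h1]
    exact Finset.sum_congr rfl fun j _ => by simp [mul_comm, hg]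
  obtain ⟨r1, r2⟩ := rank_one_perturb _ (hpd x hx) _ g hHx hgx a b hapos hab
  rw [hM]
  refine ⟨r1, ?_⟩
  rw [r2, haN, hone, hdet x hx, mul_div_cancel₀ _ hut.ne', mul_assoc, ← Real.exp_add]
  simp
end
end
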